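/- arXiv:2009.13710 — 4 statements merged into one kernel-verified Lean document; each statement's English description precedes it below -/
import Mathlib

section
/- Let ℓ ≥ 2, m ≥ 1, 0 ≤ k ≤ ℓ be integers, let 1 ≤ u < v ≤ ℓ, and let p be an integer with 1 − m ≤ p ≤ m. Then the polynomial Σ_{x_u}^{x_v} g_k^{(m)}(t) Δt ∈ ℂ[x_1,…,x_ℓ] is divisible by (x_u − x_v − p). -/
open MvPolynomial Polynomial

noncomputable section

abbrev S (ℓ : ℕ) := MvPolynomial (Fin ℓ) ℂ

def gpoly (ℓ : ℕ) : Polynomial (S ℓ) :=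
  ∏ p : Fin ℓ, (Polynomial.X - Polynomial.C (MvPolynomial.X p))

/-- Falling power f(t)^{\underline{n}} = f(t) f(t-1) ⋯ f(t-n+1). -/
def fpow {A : Type*} [CommRing A] (f : Polynomial A) (n : ℕ) : Polynomial A :=
  ∏ i ∈ Finset.range n, f.comp (Polynomial.X - (i : Polynomial A))

/-- g_k^{(m)}(t) = g(t)^{\underline{m-1}} ∏_{1 ≤ i < k}(t - x_i + 1) ∏_{k < i ≤ ℓ}(t - x_i - m + 1),
where the variables are indexed 1, …, ℓ (so x_i is `MvPolynomial.X ⟨i-1,_⟩`). -/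
def gkm (ℓ k m : ℕ) : Polynomial (S ℓ) :=
  fpow (gpoly ℓ) (m - 1) *
    (∏ i ∈ Finset.univ.filter (fun i : Fin ℓ => (i : ℕ) + 1 < k),
      (Polynomial.X - Polynomial.C (MvPolynomial.X i) + 1)) *
    (∏ i ∈ Finset.univ.filter (fun i : Fin ℓ => k < (i : ℕ) + 1),
      (Polynomial.X - Polynomial.C (MvPolynomial.X i) - ((m : Polynomial (S ℓ)) - 1)))

theorem eval_add_natCast_sub_eval {A : Type*} [CommRing A] {F G : Polynomial A}
    (h : F.comp (Polynomial.X + 1) - F = G) (a : A) (n : ℕ) :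
    F.eval (a + n) - F.eval a = ∑ j ∈ Finset.range n, G.eval (a + j) := by
  subst h
  simpa [Polynomial.eval_comp, add_assoc] using
    (Finset.sum_range_sub (fun j : ℕ => F.eval (a + j)) n).symm

theorem eval_fpow_eq_zero {A : Type*} [CommRing A] {f : Polynomial A} {a : A}
    (h : f.eval a = 0) {j n : ℕ} (hj : j < n) : (fpow f n).eval (a + j) = 0 := by
  rw [fpow, Polynomial.eval_prod]
  exact Finset.prod_eq_zero (Finset.mem_range.2 hj) (by simp [Polynomial.eval_comp, h])

theorem eval_X_gpoly {ℓ : ℕ} (i : Fin ℓ) : (gpoly ℓ).eval (MvPolynomial.X i) = 0 := by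
  rw [gpoly, Polynomial.eval_prod]
  exact Finset.prod_eq_zero (Finset.mem_univ i) (by simp)

theorem eval_gkm_eq_zero {ℓ m : ℕ} (k : ℕ) (i : Fin ℓ) {j : ℕ} (hj : j < m - 1) :
    (gkm ℓ k m).eval (MvPolynomial.X i + (j : S ℓ)) = 0 := by
  simp [gkm, eval_fpow_eq_zero (eval_X_gpoly i) hj]

theorem dvd_eval_gkm_last {ℓ k n : ℕ} {u v : Fin ℓ} (huv : u < v) :
    (MvPolynomial.X u - MvPolynomial.X v - ((n + 1 : ℕ) : S ℓ)) ∣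
      (gkm ℓ k (n + 1)).eval (MvPolynomial.X v + (n : S ℓ)) := by
  simp only [gkm, Polynomial.eval_mul, Polynomial.eval_prod]
  by_cases hv : k < (v : ℕ) + 1
  · refine Dvd.dvd.mul_left ?_ _
    rw [Finset.prod_eq_zero (i := v) (by simpa using hv) (by simp)]
    exact dvd_zero _
  · have hu : (u : ℕ) + 1 < k := by
      have : (u : ℕ) < v := huv
      omega
    refine Dvd.dvd.mul_right (Dvd.dvd.mul_left ?_ _) _
    refine Dvd.dvd.trans ?_ (Finset.dvd_prod_of_mem _ (a := u) (by simpa using hu))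
    refine ⟨-1, ?_⟩
    simp
    ring

theorem stmt13 (ℓ m k : ℕ) (hℓ : 2 ≤ ℓ) (hm : 1 ≤ m) (hk : k ≤ ℓ)
    (u v : Fin ℓ) (huv : u < v) (p : ℤ) (hp1 : 1 - (m : ℤ) ≤ p) (hp2 : p ≤ m)
    -- F is an indefinite summation (antidifference) of g_k^{(m)}(t)
    (F : Polynomial (S ℓ))
    (hF : F.comp (Polynomial.X + 1) - F = gkm ℓ k m) :
    (MvPolynomial.X u - MvPolynomial.X v - (p : S ℓ)) ∣
      (F.eval (MvPolynomial.X v) - F.eval (MvPolynomial.X u)) := by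
  obtain ⟨n, rfl | rfl⟩ := p.eq_nat_or_neg
  · have h₁ := Polynomial.sub_dvd_eval_sub (MvPolynomial.X u) (MvPolynomial.X v + (n : S ℓ)) F
    have h₂ : (MvPolynomial.X u - MvPolynomial.X v - (n : S ℓ)) ∣
        F.eval (MvPolynomial.X v + (n : S ℓ)) - F.eval (MvPolynomial.X v) := by
      rw [eval_add_natCast_sub_eval hF]
      refine Finset.dvd_sum fun j hj => ?_
      rw [Finset.mem_range] at hj
      by_cases hjm : j < m - 1
      · rw [eval_gkm_eq_zero k v hjm]
        exact dvd_zero _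
      · obtain rfl : n = j + 1 := by omega
        obtain rfl : m = j + 1 := by omega
        exact dvd_eval_gkm_last huv
    rw [← sub_sub] at h₁
    rw [Int.cast_natCast, ← dvd_neg]
    convert dvd_add h₁ h₂ using 1
    ring
  · have h₁ := Polynomial.sub_dvd_eval_sub (MvPolynomial.X u + (n : S ℓ)) (MvPolynomial.X v) F
    have h₂ : F.eval (MvPolynomial.X u + (n : S ℓ)) - F.eval (MvPolynomial.X u) = 0 := by
      rw [eval_add_natCast_sub_eval hF]
      refine Finset.sum_eq_zero fun j hj => eval_gkm_eq_zero k u ?_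
      rw [Finset.mem_range] at hj
      omega
    rw [← dvd_neg, ← sub_eq_zero.1 h₂]
    convert h₁ using 1
    · push_cast
      ring
    · ring

end
end

section
/- Let ℓ ≥ 2, m ≥ 1, 1 ≤ v ≤ ℓ, 0 ≤ k ≤ ℓ be integers, and let p be an integer with 1 ≤ p ≤ m − 1 (so m > 1). Then Σ_{s=0}^{p−1} g_k^{(m)}(x_v + s) = 0 in ℂ[x_1,…,x_ℓ]; moreover, for p = m and any 1 ≤ u < v ≤ ℓ, substituting x_u = x_v + m into Σ_{s=0}^{m−1} g_k^{(m)}(x_v + s) yields 0. -/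
open MvPolynomial Polynomial

noncomputable section

/-- The falling-power factor makes `g_k^{(m)}` vanish at `x_v + s` for `0 ≤ s ≤ m - 2`. -/
theorem gkm_eval_eq_zero (ℓ k m : ℕ) (v : Fin ℓ) {s : ℕ} (hs : s < m - 1) :
    (gkm ℓ k m).eval (MvPolynomial.X v + (s : S ℓ)) = 0 := by
  have h : (fpow (gpoly ℓ) (m - 1)).eval (MvPolynomial.X v + (s : S ℓ)) = 0 := by
    rw [fpow, Polynomial.eval_prod]
    refine Finset.prod_eq_zero (Finset.mem_range.mpr hs) ?_
    rw [Polynomial.eval_comp, gpoly, Polynomial.eval_prod]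
    exact Finset.prod_eq_zero (Finset.mem_univ v) (by simp)
  rw [gkm, Polynomial.eval_mul, Polynomial.eval_mul, h, zero_mul, zero_mul]

/-- The value of `g_k^{(m)}` at `x_v + (m - 1)` vanishes after substituting `x_u = x_v + m`,
for `u < v`. -/
theorem aeval_gkm_eval_pred_eq_zero (ℓ k m : ℕ) (hm : 1 ≤ m) {u v : Fin ℓ} (huv : u < v) :
    MvPolynomial.aeval
        (fun i : Fin ℓ => if i = u then MvPolynomial.X v + (m : S ℓ) else MvPolynomial.X i)
        ((gkm ℓ k m).eval (MvPolynomial.X v + ((m - 1 : ℕ) : S ℓ))) = 0 := by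
  rw [gkm, Polynomial.eval_mul, Polynomial.eval_mul, Polynomial.eval_prod, Polynomial.eval_prod,
    map_mul, map_mul]
  by_cases hv : k < (v : ℕ) + 1
  · refine mul_eq_zero_of_right _ ?_
    rw [Finset.prod_eq_zero (i := v) (by simpa [Nat.lt_succ_iff] using hv)
      (by simp [Nat.cast_sub hm]), map_zero]
  · have hu : (u : ℕ) + 1 < k := by
      have : (u : ℕ) < v := huv
      omega
    rw [map_prod, Finset.prod_eq_zero (i := u) (by simpa using hu)
      (by simp [huv.ne', Nat.cast_sub hm]), mul_zero, zero_mul]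

theorem stmt14 (ℓ m k : ℕ) (hℓ : 2 ≤ ℓ) (hm : 1 ≤ m) (hk : k ≤ ℓ) (v : Fin ℓ) :
    (∀ p : ℕ, 1 ≤ p → p ≤ m - 1 →
      ∑ s ∈ Finset.range p, (gkm ℓ k m).eval (MvPolynomial.X v + (s : S ℓ)) = 0) ∧
    (∀ u : Fin ℓ, u < v →
      MvPolynomial.aeval
          (fun i : Fin ℓ => if i = u then MvPolynomial.X v + (m : S ℓ) else MvPolynomial.X i)
          (∑ s ∈ Finset.range m, (gkm ℓ k m).eval (MvPolynomial.X v + (s : S ℓ))) = 0) := by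
  refine ⟨fun p _ hp => Finset.sum_eq_zero fun s hs =>
    gkm_eval_eq_zero ℓ k m v ((Finset.mem_range.mp hs).trans_le hp), fun u huv => ?_⟩
  rw [Finset.sum_eq_single_of_mem (m - 1) (Finset.mem_range.mpr (by omega))
    fun s hs hne => gkm_eval_eq_zero ℓ k m v (by have := Finset.mem_range.mp hs; omega)]
  exact aeval_gkm_eval_pred_eq_zero ℓ k m hm huv

end
end

section
/- Let ℓ ≥ 2, m ≥ 1 and 1 ≤ k ≤ ℓ be integers. The top-degree homogeneous component (of degree mℓ) of the polynomial Σ_{x_i}^{x_j} g_k^{(m)}(t) Δt ∈ ℂ[x_1,…,x_ℓ] equals ∫_{x_i}^{x_j} g(t)^{m−1} g_k(t) dt; consequently the homogenized vector field τ̃_k^m restricted to z = 0 equals σ_k^m. -/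
open MvPolynomial Polynomial

noncomputable section

def defInt {A : Type*} [CommRing A] [Algebra ℚ A] (a b : A) (h : Polynomial A) : A :=
  h.sum fun n c => (((n : ℚ) + 1)⁻¹ • c) * (b ^ (n + 1) - a ^ (n + 1))

/-- g_k(t) = ∏_{p ≠ k} (t - x_p). -/
def gk (ℓ : ℕ) (k : Fin ℓ) : Polynomial (S ℓ) :=
  ∏ p ∈ Finset.univ.erase k, (Polynomial.X - Polynomial.C (MvPolynomial.X p))

/-- σ_k^m, the vector field with i-th coefficient ∑_j ∫_{x_i}^{x_j} g(t)^{m-1} g_k(t) dt. -/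
def sigmaVF (ℓ m : ℕ) (k : Fin ℓ) : Fin ℓ → S ℓ := fun i =>
  ∑ j : Fin ℓ, defInt (MvPolynomial.X i) (MvPolynomial.X j)
    (gpoly ℓ ^ (m - 1) * gk ℓ k)

/-- Every monomial `x^s t^n` of `P` has total degree `s.degree + n` in `T`. -/
def TotalDegIn {ℓ : ℕ} (T : Set ℕ) (P : Polynomial (S ℓ)) : Prop :=
  ∀ n s, MvPolynomial.coeff s (P.coeff n) ≠ 0 → s.degree + n ∈ T

namespace TotalDegIn

variable {ℓ : ℕ} {T U : Set ℕ} {P Q : Polynomial (S ℓ)}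

lemma mono (h : TotalDegIn T P) (hTU : T ⊆ U) : TotalDegIn U P :=
  fun n s hs => hTU (h n s hs)

lemma zero : TotalDegIn T (0 : Polynomial (S ℓ)) := fun n s hs => by simp at hs

lemma add (hP : TotalDegIn T P) (hQ : TotalDegIn T Q) : TotalDegIn T (P + Q) := by
  intro n s hs
  by_contra hT
  have h1 : MvPolynomial.coeff s (P.coeff n) = 0 := by_contra fun h => hT (hP n s h)
  have h2 : MvPolynomial.coeff s (Q.coeff n) = 0 := by_contra fun h => hT (hQ n s h)
  simp [h1, h2] at hs

lemma neg (hP : TotalDegIn T P) : TotalDegIn T (-P) := by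
  intro n s hs
  exact hP n s (by simpa using hs)

lemma sub (hP : TotalDegIn T P) (hQ : TotalDegIn T Q) : TotalDegIn T (P - Q) := by
  simpa [sub_eq_add_neg] using hP.add hQ.neg

lemma sum {ι : Type*} {s : Finset ι} {f : ι → Polynomial (S ℓ)}
    (h : ∀ i ∈ s, TotalDegIn T (f i)) : TotalDegIn T (∑ i ∈ s, f i) :=
  Finset.sum_induction _ _ (fun _ _ => add) zero h

lemma mul {V : Set ℕ} (hP : TotalDegIn T P) (hQ : TotalDegIn U Q)
    (hV : ∀ a ∈ T, ∀ b ∈ U, a + b ∈ V) : TotalDegIn V (P * Q) := by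
  intro n s hs
  rw [Polynomial.coeff_mul, MvPolynomial.coeff_sum] at hs
  obtain ⟨⟨a, b⟩, hab, h1⟩ := Finset.exists_ne_zero_of_sum_ne_zero hs
  rw [MvPolynomial.coeff_mul] at h1
  obtain ⟨⟨u, v⟩, huv, h2⟩ := Finset.exists_ne_zero_of_sum_ne_zero h1
  rw [Finset.HasAntidiagonal.mem_antidiagonal] at hab huv
  simp only at hab huv h2
  subst hab huv
  convert hV _ (hP a u (left_ne_zero_of_mul h2)) _ (hQ b v (right_ne_zero_of_mul h2)) using 1
  rw [map_add]
  ring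

lemma X_pow (n : ℕ) : TotalDegIn {n} ((Polynomial.X : Polynomial (S ℓ)) ^ n) := by
  intro a s hs
  rw [Polynomial.coeff_X_pow] at hs
  split_ifs at hs with h
  · rw [MvPolynomial.coeff_one] at hs
    have : s = 0 := by_contra fun h => hs (if_neg (Ne.symm h))
    simp [this, h]
  · simp at hs

lemma C_X_pow (i : Fin ℓ) (n : ℕ) :
    TotalDegIn {n} (Polynomial.C ((MvPolynomial.X i : S ℓ) ^ n)) := by
  intro a s hs
  rw [Polynomial.coeff_C] at hs
  split_ifs at hs with h
  · rw [MvPolynomial.coeff_X_pow] at hs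
    have : Finsupp.single i n = s := by_contra fun h => hs (if_neg h)
    simp [← this, h]
  · simp at hs

lemma map_rat (p : Polynomial ℚ) :
    TotalDegIn (Set.Iic p.natDegree) (p.map (algebraMap ℚ (S ℓ))) := by
  intro n s hs
  rw [Polynomial.coeff_map, IsScalarTower.algebraMap_apply ℚ ℂ (S ℓ),
    MvPolynomial.algebraMap_eq, MvPolynomial.coeff_C] at hs
  have h0 : (0 : Fin ℓ →₀ ℕ) = s := by_contra fun h => hs (if_neg h)
  rw [if_pos h0] at hs
  have : p.coeff n ≠ 0 := fun h => hs (by rw [h, map_zero])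
  simpa [← h0] using Polynomial.le_natDegree_of_ne_zero this

/-- Substituting a family `b n` for the powers of `t` moves total degrees as expected. -/
lemma sum_C_mul {U : ℕ → Set ℕ} {V : Set ℕ} {b : ℕ → Polynomial (S ℓ)} (hP : TotalDegIn T P)
    (hb : ∀ n, TotalDegIn (U n) (b n)) (hV : ∀ n a, a + n ∈ T → ∀ u ∈ U n, a + u ∈ V) :
    TotalDegIn V (P.sum fun n c => Polynomial.C c * b n) := by
  refine sum fun n _ => mul (T := {a | a + n ∈ T}) ?_ (hb n) (hV n)
  intro a s hs
  rw [Polynomial.coeff_C] at hs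
  split_ifs at hs with h
  · subst h
    exact hP n s hs
  · simp at hs

lemma C_eval (hP : TotalDegIn T P) (i : Fin ℓ) :
    TotalDegIn T (Polynomial.C (P.eval (MvPolynomial.X i))) := by
  have h : Polynomial.C (P.eval (MvPolynomial.X i)) =
      P.sum fun n c => Polynomial.C c * Polynomial.C ((MvPolynomial.X i : S ℓ) ^ n) := by
    rw [Polynomial.eval_eq_sum, Polynomial.sum_def, Polynomial.sum_def, map_sum]
    simp only [map_mul]
  rw [h]
  refine hP.sum_C_mul (C_X_pow i) ?_
  rintro n a ha u rfl
  exact ha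

lemma degree_mem {p : S ℓ} (hp : TotalDegIn T (Polynomial.C p)) {s : Fin ℓ →₀ ℕ}
    (hs : MvPolynomial.coeff s p ≠ 0) : s.degree ∈ T := by
  simpa using hp 0 s (by simpa using hs)

end TotalDegIn

/-- `Q` is the homogeneous part of total degree `d` of `P`, and `P` has no monomials of larger
total degree. -/
def IsLeadingForm {ℓ : ℕ} (d : ℕ) (P Q : Polynomial (S ℓ)) : Prop :=
  TotalDegIn {d} Q ∧ TotalDegIn (Set.Iio d) (P - Q)

namespace IsLeadingForm

variable {ℓ d e : ℕ} {P P' Q Q' : Polynomial (S ℓ)}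

lemma one : IsLeadingForm 0 (1 : Polynomial (S ℓ)) 1 :=
  ⟨by simpa using TotalDegIn.X_pow (ℓ := ℓ) 0, by simpa using TotalDegIn.zero⟩

lemma mul (h : IsLeadingForm d P Q) (h' : IsLeadingForm e P' Q') :
    IsLeadingForm (d + e) (P * P') (Q * Q') := by
  refine ⟨h.1.mul h'.1 (by simp), ?_⟩
  have : P * P' - Q * Q' = (P - Q) * (P' - Q') + Q * (P' - Q') + (P - Q) * Q' := by ring
  rw [this]
  refine ((h.2.mul h'.2 ?_).add (h.1.mul h'.2 ?_)).add (h.2.mul h'.1 ?_) <;>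
    · intro a ha b hb
      simp only [Set.mem_Iio, Set.mem_singleton_iff] at *
      omega

lemma prod {ι : Type*} (s : Finset ι) {f g : ι → Polynomial (S ℓ)}
    (h : ∀ i ∈ s, IsLeadingForm d (f i) (g i)) :
    IsLeadingForm (s.card * d) (∏ i ∈ s, f i) (∏ i ∈ s, g i) := by
  classical
  induction s using Finset.induction_on with
  | empty => simpa using one
  | insert a s ha ih =>
    rw [Finset.prod_insert ha, Finset.prod_insert ha, Finset.card_insert_of_notMem ha,
      add_mul, one_mul, add_comm]
    exact (h a (by simp)).mul (ih fun i hi => h i (by simp [hi]))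

lemma linear (i : Fin ℓ) (q : ℚ) :
    IsLeadingForm 1
      (Polynomial.X - Polynomial.C (MvPolynomial.X i) + Polynomial.C (algebraMap ℚ (S ℓ) q))
      (Polynomial.X - Polynomial.C (MvPolynomial.X i)) := by
  refine ⟨?_, ?_⟩
  · simpa using (TotalDegIn.X_pow (ℓ := ℓ) 1).sub (TotalDegIn.C_X_pow i 1)
  · rw [add_sub_cancel_left, ← Polynomial.map_C]
    exact (TotalDegIn.map_rat _).mono (by simp)

lemma eval_sub_eval (h : IsLeadingForm d P Q) (i j : Fin ℓ) :
    (P.eval (MvPolynomial.X j) - P.eval (MvPolynomial.X i)).totalDegree ≤ d ∧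
      MvPolynomial.homogeneousComponent d
        (P.eval (MvPolynomial.X j) - P.eval (MvPolynomial.X i)) =
        Q.eval (MvPolynomial.X j) - Q.eval (MvPolynomial.X i) := by
  set q := Q.eval (MvPolynomial.X j) - Q.eval (MvPolynomial.X i) with hq
  set r := (P - Q).eval (MvPolynomial.X j) - (P - Q).eval (MvPolynomial.X i) with hr
  have hpqr : P.eval (MvPolynomial.X j) - P.eval (MvPolynomial.X i) = q + r := by
    rw [hq, hr, Polynomial.eval_sub, Polynomial.eval_sub]
    ring
  have hqd : TotalDegIn {d} (Polynomial.C q) := by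
    rw [hq, map_sub]
    exact (h.1.C_eval j).sub (h.1.C_eval i)
  have hrd : TotalDegIn (Set.Iio d) (Polynomial.C r) := by
    rw [hr, map_sub]
    exact (h.2.C_eval j).sub (h.2.C_eval i)
  rw [hpqr]
  constructor
  · have hqr : TotalDegIn (Set.Iic d) (Polynomial.C (q + r)) := by
      rw [map_add]
      exact (hqd.mono (by simp)).add (hrd.mono Set.Iio_subset_Iic_self)
    rw [MvPolynomial.totalDegree, Finset.sup_le_iff]
    intro s hs
    exact hqr.degree_mem (MvPolynomial.mem_support_iff.mp hs)
  · ext s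
    rw [MvPolynomial.coeff_homogeneousComponent]
    split_ifs with hsd
    · have : MvPolynomial.coeff s r = 0 := by
        by_contra hne
        have := hrd.degree_mem hne
        simp [hsd] at this
      simp [this]
    · by_contra hne
      exact hsd (hqd.degree_mem (Ne.symm hne))

end IsLeadingForm

/-- The formal antiderivative with zero constant term. -/
def antideriv {ℓ : ℕ} (P : Polynomial (S ℓ)) : Polynomial (S ℓ) :=
  P.sum fun n c => Polynomial.C c *
    (Polynomial.C ((n + 1 : ℚ)⁻¹) * Polynomial.X ^ (n + 1)).map (algebraMap ℚ (S ℓ))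

/-- The antidifference sending `t ^ n` to `B_{n+1}(t) / (n + 1)`. -/
def antidiff {ℓ : ℕ} (P : Polynomial (S ℓ)) : Polynomial (S ℓ) :=
  P.sum fun n c => Polynomial.C c *
    (Polynomial.C ((n + 1 : ℚ)⁻¹) * Polynomial.bernoulli (n + 1)).map (algebraMap ℚ (S ℓ))

section Antidifference

variable {ℓ : ℕ}

lemma defInt_eq_eval_antideriv (a b : S ℓ) (P : Polynomial (S ℓ)) :
    defInt a b P = (antideriv P).eval b - (antideriv P).eval a := by
  simp only [defInt, antideriv, Polynomial.sum_def, Polynomial.eval_finsetSum,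
    ← Finset.sum_sub_distrib]
  refine Finset.sum_congr rfl fun n _ => ?_
  simp only [Algebra.smul_def, Polynomial.map_mul, Polynomial.map_C, Polynomial.map_pow,
    Polynomial.map_X, Polynomial.eval_mul, Polynomial.eval_C, Polynomial.eval_pow,
    Polynomial.eval_X]
  ring

lemma antidiff_add (P Q : Polynomial (S ℓ)) : antidiff (P + Q) = antidiff P + antidiff Q :=
  Polynomial.sum_add_index _ _ _ (by simp) (by simp [add_mul])

lemma antidiff_comp_X_add_one_sub (P : Polynomial (S ℓ)) :
    (antidiff P).comp (Polynomial.X + 1) - antidiff P = P := by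
  conv_rhs => rw [P.as_sum_support_C_mul_X_pow]
  simp only [antidiff, Polynomial.sum_def, Polynomial.sum_comp, ← Finset.sum_sub_distrib]
  refine Finset.sum_congr rfl fun n _ => ?_
  rw [Polynomial.mul_comp, Polynomial.C_comp, ← mul_sub]
  congr 1
  have hX : (Polynomial.X + 1 : Polynomial (S ℓ)) =
      (1 + Polynomial.X : Polynomial ℚ).map (algebraMap ℚ (S ℓ)) := by
    simp [add_comm]
  rw [hX, ← Polynomial.map_comp, ← Polynomial.map_sub, Polynomial.mul_comp, Polynomial.C_comp,
    ← mul_sub, Polynomial.bernoulli_comp_one_add_X]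
  have hn : (n + 1 : ℚ) ≠ 0 := by positivity
  have : Polynomial.C ((n + 1 : ℚ)⁻¹) * ((n + 1) • (Polynomial.X : Polynomial ℚ) ^ n) =
      Polynomial.X ^ n := by
    rw [nsmul_eq_mul, ← mul_assoc, ← Polynomial.C_eq_natCast, ← Polynomial.C_mul]
    push_cast
    rw [inv_mul_cancel₀ hn, Polynomial.C_1, one_mul]
  rw [add_sub_cancel_left, Nat.add_sub_cancel, this, Polynomial.map_pow, Polynomial.map_X]

lemma eq_C_of_comp_X_add_one_eq {A : Type*} [CommRing A] [IsDomain A] [CharZero A]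
    {D : Polynomial A} (h : D.comp (Polynomial.X + 1) = D) : D = Polynomial.C (D.eval 0) := by
  have hn : ∀ n : ℕ, D.eval (n : A) = D.eval 0 := by
    intro n
    induction n with
    | zero => simp
    | succ n ih =>
      rw [← ih]
      conv_rhs => rw [← h]
      simp
  refine Polynomial.eq_of_infinite_eval_eq _ _
    ((Set.infinite_range_of_injective (Nat.cast_injective (R := A))).mono ?_)
  rintro _ ⟨n, rfl⟩
  simp [hn n]

lemma eval_sub_eval_eq_antidiff {F P : Polynomial (S ℓ)}
    (hF : F.comp (Polynomial.X + 1) - F = P) (a b : S ℓ) :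
    F.eval b - F.eval a = (antidiff P).eval b - (antidiff P).eval a := by
  have h : (F - antidiff P).comp (Polynomial.X + 1) = F - antidiff P := by
    rw [Polynomial.sub_comp]
    linear_combination hF - antidiff_comp_X_add_one_sub P
  have hC := eq_C_of_comp_X_add_one_eq h
  have hb := congrArg (Polynomial.eval b) hC
  have ha := congrArg (Polynomial.eval a) hC
  simp only [Polynomial.eval_sub, Polynomial.eval_C] at ha hb
  linear_combination hb - ha

lemma IsLeadingForm.antidiff {d : ℕ} {P Q : Polynomial (S ℓ)} (h : IsLeadingForm d P Q) :
    IsLeadingForm (d + 1) (antidiff P) (antideriv Q) := by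
  constructor
  · refine h.1.sum_C_mul (U := fun n => {n + 1}) (fun n => ?_) ?_
    · rw [Polynomial.map_mul, Polynomial.map_pow, Polynomial.map_X]
      refine (TotalDegIn.map_rat _).mul (TotalDegIn.X_pow (n + 1)) ?_
      simp
    · simp only [Set.mem_singleton_iff]
      omega
  · have hlow : ∀ n : ℕ, (Polynomial.C ((n + 1 : ℚ)⁻¹) *
        (Polynomial.bernoulli (n + 1) - Polynomial.X ^ (n + 1))).natDegree ≤ n := by
      intro n
      refine (Polynomial.natDegree_C_mul_le _ _).trans
        (Polynomial.natDegree_le_iff_coeff_eq_zero.mpr fun i hi => ?_)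
      rw [Polynomial.coeff_sub, Polynomial.coeff_bernoulli, Polynomial.coeff_X_pow]
      obtain rfl | hi' : i = n + 1 ∨ n + 1 < i := by omega
      · simp
      · rw [if_neg (by omega), if_neg (by omega), sub_zero]
    have hsplit : _root_.antidiff P - antideriv Q = _root_.antidiff (P - Q) +
        Q.sum fun n c => Polynomial.C c * (Polynomial.C ((n + 1 : ℚ)⁻¹) *
          (Polynomial.bernoulli (n + 1) - Polynomial.X ^ (n + 1))).map
            (algebraMap ℚ (S ℓ)) := by
      have : (Q.sum fun n c => Polynomial.C c * (Polynomial.C ((n + 1 : ℚ)⁻¹) *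
          (Polynomial.bernoulli (n + 1) - Polynomial.X ^ (n + 1))).map
            (algebraMap ℚ (S ℓ))) = _root_.antidiff Q - antideriv Q := by
        simp only [_root_.antidiff, antideriv, Polynomial.sum_def, ← Finset.sum_sub_distrib,
          mul_sub, Polynomial.map_sub]
      rw [this, ← add_sub_assoc, ← antidiff_add, sub_add_cancel]
    rw [hsplit]
    refine .add (h.2.sum_C_mul (U := fun n => Set.Iic (n + 1)) (fun n => ?_) ?_)
      (h.1.sum_C_mul (U := fun n => Set.Iic n) (fun n => ?_) ?_)
    · refine (TotalDegIn.map_rat _).mono (Set.Iic_subset_Iic.mpr ?_)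
      refine (Polynomial.natDegree_C_mul_le _ _).trans
        (Polynomial.natDegree_le_iff_coeff_eq_zero.mpr fun i hi => ?_)
      rw [Polynomial.coeff_bernoulli, if_neg (by omega)]
    · simp only [Set.mem_Iio, Set.mem_Iic]
      omega
    · exact (TotalDegIn.map_rat _).mono (Set.Iic_subset_Iic.mpr (hlow n))
    · simp only [Set.mem_singleton_iff, Set.mem_Iio, Set.mem_Iic]
      omega

end Antidifference

lemma isLeadingForm_fpow_gpoly (ℓ n : ℕ) :
    IsLeadingForm (n * ℓ) (fpow (gpoly ℓ) n) (gpoly ℓ ^ n) := by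
  have h : ∀ a : ℕ, IsLeadingForm ℓ
      ((gpoly ℓ).comp (Polynomial.X - (a : Polynomial (S ℓ)))) (gpoly ℓ) := by
    intro a
    have := IsLeadingForm.prod (d := 1) (Finset.univ : Finset (Fin ℓ))
      fun i _ => IsLeadingForm.linear i (-a)
    rw [Finset.card_univ, Fintype.card_fin, mul_one] at this
    rw [← gpoly] at this
    convert this using 1
    rw [gpoly, Polynomial.prod_comp]
    refine Finset.prod_congr rfl fun i _ => ?_
    simp only [Polynomial.sub_comp, Polynomial.X_comp, Polynomial.C_comp, map_neg, map_natCast]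
    ring
  simpa [fpow] using IsLeadingForm.prod (Finset.range n) fun a _ => h a

lemma isLeadingForm_gkm {ℓ m k : ℕ} (k' : Fin ℓ) (hk : (k' : ℕ) + 1 = k) :
    IsLeadingForm ((m - 1) * ℓ + (ℓ - 1)) (gkm ℓ k m) (gpoly ℓ ^ (m - 1) * gk ℓ k') := by
  rw [gkm, mul_assoc]
  refine (isLeadingForm_fpow_gpoly ℓ (m - 1)).mul ?_
  have h := IsLeadingForm.prod (d := 1) (Finset.univ.erase k')
    fun i _ => IsLeadingForm.linear i (if (i : ℕ) + 1 < k then 1 else 1 - m)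
  rw [Finset.card_erase_of_mem (Finset.mem_univ _), Finset.card_univ, Fintype.card_fin,
    mul_one] at h
  rw [← gk] at h
  convert h using 1
  rw [← Finset.prod_filter_mul_prod_filter_not (Finset.univ.erase k')
    (fun i : Fin ℓ => (i : ℕ) + 1 < k)]
  have h1 : (Finset.univ.erase k').filter (fun i : Fin ℓ => (i : ℕ) + 1 < k) =
      Finset.univ.filter fun i : Fin ℓ => (i : ℕ) + 1 < k := by
    ext i
    simp only [Finset.mem_filter, Finset.mem_erase, Finset.mem_univ, Fin.ext_iff, ne_eq,
      and_true, true_and]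
    omega
  have h2 : (Finset.univ.erase k').filter (fun i : Fin ℓ => ¬ (i : ℕ) + 1 < k) =
      Finset.univ.filter fun i : Fin ℓ => k < (i : ℕ) + 1 := by
    ext i
    simp only [Finset.mem_filter, Finset.mem_erase, Finset.mem_univ, Fin.ext_iff, ne_eq,
      and_true, true_and]
    omega
  rw [h1, h2]
  congr 1
  · refine Finset.prod_congr rfl fun i hi => ?_
    rw [if_pos (Finset.mem_filter.mp hi).2]
    simp
  · refine Finset.prod_congr rfl fun i hi => ?_
    rw [if_neg (not_lt.mpr (Finset.mem_filter.mp hi).2.le)]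
    simp only [map_sub, map_one, map_natCast]
    ring

theorem stmt15 (ℓ m k : ℕ) (hℓ : 2 ≤ ℓ) (hm : 1 ≤ m) (hk1 : 1 ≤ k) (hk2 : k ≤ ℓ)
    -- F is an indefinite summation (antidifference) of g_k^{(m)}(t)
    (F : Polynomial (S ℓ))
    (hF : F.comp (Polynomial.X + 1) - F = gkm ℓ k m) :
    (∀ i j : Fin ℓ,
      (F.eval (MvPolynomial.X j) - F.eval (MvPolynomial.X i)).totalDegree ≤ m * ℓ ∧
      MvPolynomial.homogeneousComponent (m * ℓ)
          (F.eval (MvPolynomial.X j) - F.eval (MvPolynomial.X i)) =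
        defInt (MvPolynomial.X i) (MvPolynomial.X j)
          (gpoly ℓ ^ (m - 1) * gk ℓ ⟨k - 1, by omega⟩)) ∧
    -- consequently, the homogenized τ̃_k^m restricted to z = 0 equals σ_k^m:
    (∀ i : Fin ℓ,
      MvPolynomial.homogeneousComponent (m * ℓ)
          (∑ j : Fin ℓ, (F.eval (MvPolynomial.X j) - F.eval (MvPolynomial.X i))) =
        sigmaVF ℓ m ⟨k - 1, by omega⟩ i) := by
  have hlead := (isLeadingForm_gkm (ℓ := ℓ) (m := m) (k := k) ⟨k - 1, by omega⟩
    (Nat.sub_add_cancel hk1)).antidiff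
  have hdeg : (m - 1) * ℓ + (ℓ - 1) + 1 = m * ℓ := by
    obtain ⟨n, rfl⟩ := Nat.exists_eq_add_of_le' hm
    rw [Nat.add_sub_cancel, add_mul]
    omega
  rw [hdeg] at hlead
  have hpair : ∀ i j : Fin ℓ,
      (F.eval (MvPolynomial.X j) - F.eval (MvPolynomial.X i)).totalDegree ≤ m * ℓ ∧
      MvPolynomial.homogeneousComponent (m * ℓ)
          (F.eval (MvPolynomial.X j) - F.eval (MvPolynomial.X i)) =
        defInt (MvPolynomial.X i) (MvPolynomial.X j)
          (gpoly ℓ ^ (m - 1) * gk ℓ ⟨k - 1, by omega⟩) := by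
    intro i j
    rw [eval_sub_eval_eq_antidiff hF, defInt_eq_eval_antideriv]
    exact hlead.eval_sub_eval i j
  refine ⟨hpair, fun i => ?_⟩
  rw [map_sum, sigmaVF]
  exact Finset.sum_congr rfl fun j _ => (hpair i j).2

end
end

section
/- Let ℓ ≥ 2 and m ≥ 1 be integers. The ℓ + 1 vectors τ̃_1^m − τ̃_2^m, τ̃_2^m − τ̃_3^m, …, τ̃_{ℓ−1}^m − τ̃_ℓ^m, θ_0, θ_E form a basis of the ℂ[x_1,…,x_ℓ,z]-module D(cShi_ℓ(m)); that is, they are linearly independent over ℂ[x_1,…,x_ℓ,z] and generate D(cShi_ℓ(m)). -/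
open MvPolynomial Polynomial

noncomputable section

/-- R = ℂ[x_1, …, x_ℓ, z]; the variable indexed by `Fin.last ℓ` is z. -/
abbrev R (ℓ : ℕ) := MvPolynomial (Fin (ℓ + 1)) ℂ

/-- Homogenization z^d f(x_1/z, …, x_ℓ/z) of a polynomial of degree ≤ d. -/
def homog (ℓ d : ℕ) (f : S ℓ) : R ℓ :=
  f.support.sum fun e => MvPolynomial.monomial
    (Finsupp.mapDomain Fin.castSucc e +
      Finsupp.single (Fin.last ℓ) (d - e.sum fun _ n => n))
    (MvPolynomial.coeff e f)

/-- Homogenization of a polynomial vector field δ = ∑ f_i ∂_i, using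
d = max_i deg f_i; the ∂_z-component is 0. -/
def vfHomog (ℓ : ℕ) (δ : Fin ℓ → S ℓ) : Fin (ℓ + 1) → R ℓ := fun i =>
  if h : (i : ℕ) < ℓ then
    homog ℓ (Finset.univ.sup fun a => (δ a).totalDegree) (δ ⟨i, h⟩)
  else 0

/-- The vector field τ_k^m built from an antidifference F of g_k^{(m)}(t):
its i-th coefficient is ∑_j Σ_{x_i}^{x_j} g_k^{(m)}(t) Δt = ∑_j (F(x_j) - F(x_i)). -/
def tauVF (ℓ : ℕ) (F : Polynomial (S ℓ)) : Fin ℓ → S ℓ := fun i =>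
  ∑ j : Fin ℓ, (F.eval (MvPolynomial.X j) - F.eval (MvPolynomial.X i))

/-- θ_0 = ∂_1 + ⋯ + ∂_ℓ as a vector field on ℂ^{ℓ+1}. -/
def theta0c (ℓ : ℕ) : Fin (ℓ + 1) → R ℓ := fun i => if (i : ℕ) < ℓ then 1 else 0

/-- The Euler vector field θ_E = z ∂_z + x_1 ∂_1 + ⋯ + x_ℓ ∂_ℓ. -/
def thetaE (ℓ : ℕ) : Fin (ℓ + 1) → R ℓ := fun i => MvPolynomial.X i

/-- D(cShi_ℓ(m)). -/
def DcShi (ℓ m : ℕ) : Submodule (R ℓ) (Fin (ℓ + 1) → R ℓ) where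
  carrier := {f | MvPolynomial.X (Fin.last ℓ) ∣ f (Fin.last ℓ) ∧
    ∀ i j : Fin ℓ, i < j → ∀ p : ℤ, 1 - (m : ℤ) ≤ p → p ≤ m →
      (MvPolynomial.X i.castSucc - MvPolynomial.X j.castSucc -
          (p : R ℓ) * MvPolynomial.X (Fin.last ℓ)) ∣
        (f i.castSucc - f j.castSucc - (p : R ℓ) * f (Fin.last ℓ))}
  zero_mem' := by
    refine ⟨by simp, ?_⟩
    intro i j _ p _ _
    simp
  add_mem' := by
    intro f g hf hg
    refine ⟨?_, ?_⟩
    · have := hf.1.add hg.1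
      simpa using this
    · intro i j hij p hp1 hp2
      have h := (hf.2 i j hij p hp1 hp2).add (hg.2 i j hij p hp1 hp2)
      have e : (f i.castSucc - f j.castSucc - (p : R ℓ) * f (Fin.last ℓ)) +
          (g i.castSucc - g j.castSucc - (p : R ℓ) * g (Fin.last ℓ)) =
          (f + g) i.castSucc - (f + g) j.castSucc - (p : R ℓ) * (f + g) (Fin.last ℓ) := by
        simp only [Pi.add_apply]; ring
      rwa [e] at h
  smul_mem' := by
    intro c f hf
    refine ⟨?_, ?_⟩
    · have := hf.1.mul_left c
      simpa using this
    · intro i j hij p hp1 hp2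
      have h := (hf.2 i j hij p hp1 hp2).mul_left c
      have e : c * (f i.castSucc - f j.castSucc - (p : R ℓ) * f (Fin.last ℓ)) =
          (c • f) i.castSucc - (c • f) j.castSucc - (p : R ℓ) * (c • f) (Fin.last ℓ) := by
        simp only [Pi.smul_apply, smul_eq_mul]; ring
      rwa [e] at h

/-- The family τ̃_1^m − τ̃_2^m, …, τ̃_{ℓ-1}^m − τ̃_ℓ^m, θ_0, θ_E
(θ_0 at index ℓ-1, θ_E at the last index). -/
def shiBasis (ℓ : ℕ) (F : ℕ → Polynomial (S ℓ)) : Fin (ℓ + 1) → (Fin (ℓ + 1) → R ℓ) :=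
  fun a =>
    if (a : ℕ) < ℓ - 1 then
      vfHomog ℓ (tauVF ℓ (F ((a : ℕ) + 1))) - vfHomog ℓ (tauVF ℓ (F ((a : ℕ) + 2)))
    else if (a : ℕ) = ℓ - 1 then theta0c ℓ
    else thetaE ℓ

/-- Every monomial `x ^ e * t ^ n` of `f` has total degree `|e| + n ≤ d`. -/
def JointDegreeLE {ℓ : ℕ} (d : ℕ) (f : Polynomial (S ℓ)) : Prop :=
  ∀ n e, MvPolynomial.coeff e (f.coeff n) ≠ 0 → e.degree + n ≤ d

lemma JointDegreeLE.mul {ℓ a b : ℕ} {f g : Polynomial (S ℓ)} (hf : JointDegreeLE a f)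
    (hg : JointDegreeLE b g) : JointDegreeLE (a + b) (f * g) := by
  classical
  intro n e h
  rw [Polynomial.coeff_mul, MvPolynomial.coeff_sum] at h
  obtain ⟨⟨i, j⟩, hij, h⟩ := Finset.exists_ne_zero_of_sum_ne_zero h
  rw [MvPolynomial.coeff_mul] at h
  obtain ⟨⟨e₁, e₂⟩, he, h⟩ := Finset.exists_ne_zero_of_sum_ne_zero h
  rw [Finset.HasAntidiagonal.mem_antidiagonal] at hij he
  dsimp only at hij he h
  have h₁ := hf i e₁ (left_ne_zero_of_mul h)
  have h₂ := hg j e₂ (right_ne_zero_of_mul h)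
  rw [← he, ← hij, map_add]
  omega

lemma jointDegreeLE_one {ℓ : ℕ} : JointDegreeLE 0 (1 : Polynomial (S ℓ)) := by
  classical
  intro n e h
  rw [Polynomial.coeff_one] at h
  split_ifs at h with hn
  · rw [MvPolynomial.coeff_one] at h
    have he : 0 = e := by by_contra he; simp [he] at h
    simp [← he, hn]
  · simp at h

lemma JointDegreeLE.prod {ℓ : ℕ} {ι : Type*} (s : Finset ι) (f : ι → Polynomial (S ℓ)) (d : ℕ)
    (h : ∀ i ∈ s, JointDegreeLE d (f i)) : JointDegreeLE (s.card * d) (∏ i ∈ s, f i) := by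
  classical
  induction s using Finset.induction_on with
  | empty => simpa using jointDegreeLE_one
  | insert a s ha ih =>
    rw [Finset.prod_insert ha, Finset.card_insert_of_notMem ha, add_mul, one_mul, add_comm]
    exact (h a (by simp)).mul (ih fun i hi => h i (by simp [hi]))

lemma jointDegreeLE_X_sub_C {ℓ : ℕ} (p : Fin ℓ) (c : ℂ) :
    JointDegreeLE 1 (Polynomial.X - Polynomial.C (MvPolynomial.X p + MvPolynomial.C c)) := by
  classical
  intro n e h
  rw [Polynomial.coeff_sub, Polynomial.coeff_X, Polynomial.coeff_C] at h
  rcases n with _ | _ | n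
  · simp only [zero_ne_one.symm, if_false, if_true, zero_sub, MvPolynomial.coeff_neg,
      neg_ne_zero, MvPolynomial.coeff_add, MvPolynomial.coeff_X, MvPolynomial.coeff_C] at h
    by_cases h₁ : Finsupp.single p 1 = e
    · simp [← h₁]
    · by_cases h₂ : 0 = e
      · simp [← h₂]
      · simp [h₁, h₂] at h
  · by_cases h₂ : 0 = e
    · simp [← h₂]
    · simp [MvPolynomial.coeff_one, h₂] at h
  · simp at h

lemma coeff_comp_X_add_one {A : Type*} [CommRing A] (f : Polynomial A) (n : ℕ) :
    (f.comp (Polynomial.X + 1)).coeff n = ∑ j ∈ f.support, (j.choose n : A) * f.coeff j := by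
  have h := Polynomial.taylor_coeff 1 f n
  rw [Polynomial.taylor_apply, map_one] at h
  rw [h, Polynomial.hasseDeriv_apply, Polynomial.sum_def, Polynomial.eval_finsetSum]
  simp

lemma map_coeff_comp_X_add_one_sub {A B : Type*} [CommRing A] [AddCommGroup B] (φ : A →+ B)
    (f : Polynomial A) (M : ℕ) (h : ∀ j, M + 1 < j → φ (f.coeff j) = 0) :
    φ ((f.comp (Polynomial.X + 1) - f).coeff M) = (M + 1) • φ (f.coeff (M + 1)) := by
  classical
  rw [Polynomial.coeff_sub, coeff_comp_X_add_one, map_sub, map_sum]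
  simp only [← nsmul_eq_mul, map_nsmul]
  rw [Finset.sum_subset (Finset.subset_union_left (s₂ := {M, M + 1}))
      (fun j _ hj => by rw [Polynomial.notMem_support_iff.1 hj]; simp),
    ← Finset.sum_subset (Finset.subset_union_right (s₁ := f.support) (s₂ := {M, M + 1})),
    Finset.sum_pair (by omega)]
  · simp
  · intro j _ hj
    simp only [Finset.mem_insert, Finset.mem_singleton, not_or] at hj
    rcases Nat.lt_or_ge j M with hlt | hge
    · simp [Nat.choose_eq_zero_of_lt hlt]
    · simp [h j (by omega)]

/-- An antidifference has joint degree at most one more, up to its constant coefficient. -/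
lemma degree_add_le_of_antidifference {ℓ d : ℕ} {f g : Polynomial (S ℓ)}
    (hfg : f.comp (Polynomial.X + 1) - f = g) (hg : JointDegreeLE d g) (n : ℕ) (hn : 1 ≤ n)
    (e : Fin ℓ →₀ ℕ) (he : MvPolynomial.coeff e (f.coeff n) ≠ 0) : e.degree + n ≤ d + 1 := by
  classical
  have mem : ∀ {j}, MvPolynomial.coeff e (f.coeff j) ≠ 0 → j ∈ f.support := fun {j} hj => by
    rw [Polynomial.mem_support_iff]; rintro h; simp [h] at hj
  obtain ⟨N, hN, hmax⟩ := (f.support.filter fun j => MvPolynomial.coeff e (f.coeff j) ≠ 0)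
    |>.exists_max_image id ⟨n, by simpa [he] using mem he⟩
  rw [Finset.mem_filter] at hN
  have hle : ∀ {j}, MvPolynomial.coeff e (f.coeff j) ≠ 0 → j ≤ N := fun {j} hj =>
    hmax j (by simpa [hj] using mem hj)
  obtain ⟨M, rfl⟩ : ∃ M, N = M + 1 := ⟨N - 1, by have := hle he; omega⟩
  have key : MvPolynomial.coeff e (g.coeff M) = (M + 1) • MvPolynomial.coeff e (f.coeff (M + 1)) := by
    rw [← hfg]
    exact map_coeff_comp_X_add_one_sub (MvPolynomial.coeffAddMonoidHom e) f M fun j hj => by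
      by_contra h
      have := hle h
      omega
  have h₁ : MvPolynomial.coeff e (g.coeff M) ≠ 0 := by
    rw [key]; exact smul_ne_zero M.succ_ne_zero hN.2
  have := hg M e h₁
  have := hle he
  omega

lemma totalDegree_eval_sub_eval_le {ℓ d : ℕ} (f : Polynomial (S ℓ))
    (hf : ∀ n, 1 ≤ n → ∀ e, MvPolynomial.coeff e (f.coeff n) ≠ 0 → e.degree + n ≤ d)
    (i j : Fin ℓ) :
    (f.eval (MvPolynomial.X j) - f.eval (MvPolynomial.X i)).totalDegree ≤ d := by
  rw [Polynomial.eval_eq_sum, Polynomial.eval_eq_sum, Polynomial.sum_def, Polynomial.sum_def,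
    ← Finset.sum_sub_distrib]
  refine MvPolynomial.totalDegree_finsetSum_le fun n hn => ?_
  rcases Nat.eq_zero_or_pos n with rfl | hpos
  · simp
  have hX : ∀ k : Fin ℓ, (f.coeff n * MvPolynomial.X k ^ n).totalDegree ≤ d := fun k => by
    refine (MvPolynomial.totalDegree_mul _ _).trans ?_
    rw [MvPolynomial.totalDegree_X_pow]
    have hne : (f.coeff n).support.Nonempty := by
      rw [Finset.nonempty_iff_ne_empty, Ne, MvPolynomial.support_eq_empty]
      exact Polynomial.mem_support_iff.1 hn
    obtain ⟨e, he, hmax⟩ := Finset.exists_mem_eq_sup _ hne fun s : Fin ℓ →₀ ℕ => s.sum fun _ k => k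
    have h := hf n hpos e (MvPolynomial.mem_support_iff.1 he)
    exact (congrArg (· + n) hmax).trans_le h
  exact (MvPolynomial.totalDegree_sub _ _).trans (max_le (hX j) (hX i))

lemma gkm_eq (ℓ k m : ℕ) (hm : 1 ≤ m) : gkm ℓ k m =
    (∏ i ∈ Finset.range (m - 1), ∏ p : Fin ℓ,
      (Polynomial.X - Polynomial.C (MvPolynomial.X p + MvPolynomial.C (i : ℂ)))) *
    (∏ i ∈ Finset.univ.filter (fun i : Fin ℓ => (i : ℕ) + 1 < k),
      (Polynomial.X - Polynomial.C (MvPolynomial.X i + MvPolynomial.C (-1)))) *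
    (∏ i ∈ Finset.univ.filter (fun i : Fin ℓ => k < (i : ℕ) + 1),
      (Polynomial.X - Polynomial.C (MvPolynomial.X i + MvPolynomial.C ((m - 1 : ℕ) : ℂ)))) := by
  unfold gkm fpow gpoly
  refine congrArg₂ (· * ·) (congrArg₂ (· * ·) ?_ ?_) ?_
  · refine Finset.prod_congr rfl fun i _ => ?_
    rw [Polynomial.prod_comp]
    refine Finset.prod_congr rfl fun p _ => ?_
    rw [Polynomial.sub_comp, Polynomial.X_comp, Polynomial.C_comp, Polynomial.C_add, map_natCast,
      map_natCast]
    ring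
  · refine Finset.prod_congr rfl fun i _ => ?_
    rw [map_neg, map_one, Polynomial.C_add, Polynomial.C_neg, Polynomial.C_1]
    ring
  · refine Finset.prod_congr rfl fun i _ => ?_
    rw [map_natCast, Polynomial.C_add, map_natCast, Nat.cast_sub hm, Nat.cast_one]
    ring

lemma card_filter_add_card_filter {ℓ k : ℕ} (hk : 1 ≤ k) (hkℓ : k ≤ ℓ) :
    (Finset.univ.filter (fun i : Fin ℓ => (i : ℕ) + 1 < k)).card +
      (Finset.univ.filter (fun i : Fin ℓ => k < (i : ℕ) + 1)).card = ℓ - 1 := by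
  have h : (Finset.univ.filter (fun i : Fin ℓ => (i : ℕ) + 1 < k)) ∪
      (Finset.univ.filter (fun i : Fin ℓ => k < (i : ℕ) + 1)) =
      Finset.univ.erase ⟨k - 1, by omega⟩ := by
    ext i
    simp only [Finset.mem_union, Finset.mem_filter, Finset.mem_univ, true_and, Finset.mem_erase,
      and_true, Ne, Fin.ext_iff]
    omega
  rw [← Finset.card_union_of_disjoint, h, Finset.card_erase_of_mem (Finset.mem_univ _),
    Finset.card_univ, Fintype.card_fin]
  exact Finset.disjoint_filter.2 fun i _ h₁ h₂ => by omega

lemma sub_one_mul_add_sub_one {ℓ m : ℕ} (hℓ : 1 ≤ ℓ) (hm : 1 ≤ m) :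
    (m - 1) * ℓ + (ℓ - 1) = ℓ * m - 1 := by
  obtain ⟨n, rfl⟩ : ∃ n, m = n + 1 := ⟨m - 1, by omega⟩
  rw [Nat.add_sub_cancel, mul_add, mul_one, mul_comm]
  omega

lemma jointDegreeLE_gkm {ℓ k m : ℕ} (hm : 1 ≤ m) (hk : 1 ≤ k) (hkℓ : k ≤ ℓ) :
    JointDegreeLE (ℓ * m - 1) (gkm ℓ k m) := by
  rw [gkm_eq ℓ k m hm, ← sub_one_mul_add_sub_one (hk.trans hkℓ) hm,
    ← card_filter_add_card_filter hk hkℓ, ← add_assoc]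
  have h : ∀ (s : Finset (Fin ℓ)) (c : ℂ), JointDegreeLE s.card (∏ p ∈ s, (Polynomial.X -
      Polynomial.C (MvPolynomial.X p + MvPolynomial.C c : S ℓ))) := fun s c => by
    rw [← mul_one s.card]
    exact JointDegreeLE.prod s _ 1 fun p _ => jointDegreeLE_X_sub_C p c
  refine JointDegreeLE.mul (JointDegreeLE.mul ?_ (h _ _)) (h _ _)
  have h₁ := JointDegreeLE.prod (Finset.range (m - 1)) _ ℓ fun i _ => by
    have := h Finset.univ (i : ℂ)
    rwa [Finset.card_fin] at this
  rwa [Finset.card_range] at h₁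

lemma monic_gkm (ℓ k m : ℕ) (hm : 1 ≤ m) : (gkm ℓ k m).Monic := by
  rw [gkm_eq ℓ k m hm]
  refine ((Polynomial.monic_prod_of_monic _ _ fun i _ => ?_).mul ?_).mul ?_
  all_goals exact Polynomial.monic_prod_of_monic _ _ fun p _ => Polynomial.monic_X_sub_C _

lemma natDegree_gkm {ℓ k m : ℕ} (hm : 1 ≤ m) (hk : 1 ≤ k) (hkℓ : k ≤ ℓ) :
    (gkm ℓ k m).natDegree = ℓ * m - 1 := by
  have h : ∀ (s : Finset (Fin ℓ)) (c : ℂ), (∏ p ∈ s, (Polynomial.X -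
      Polynomial.C (MvPolynomial.X p + MvPolynomial.C c : S ℓ))).Monic := fun s c =>
    Polynomial.monic_prod_of_monic _ _ fun p _ => Polynomial.monic_X_sub_C _
  have h' := fun i (_ : i ∈ Finset.range (m - 1)) => h Finset.univ (i : ℂ)
  have hp := Polynomial.monic_prod_of_monic _ _ h'
  rw [gkm_eq ℓ k m hm, (hp.mul (h _ _)).natDegree_mul (h _ _), hp.natDegree_mul (h _ _),
    Polynomial.natDegree_prod_of_monic _ _ h']
  simp only [Polynomial.natDegree_finsetProd_X_sub_C_eq_card]
  rw [add_assoc, card_filter_add_card_filter hk hkℓ, ← sub_one_mul_add_sub_one (hk.trans hkℓ) hm]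
  simp

lemma degree_gkm_sub_gkm_lt {ℓ k k' m : ℕ} (hm : 1 ≤ m) (hk : 1 ≤ k) (hkℓ : k ≤ ℓ)
    (hk' : 1 ≤ k') (hkℓ' : k' ≤ ℓ) :
    (gkm ℓ k m - gkm ℓ k' m).degree < ((ℓ * m - 1 : ℕ) : WithBot ℕ) := by
  have h := monic_gkm ℓ k m hm
  have h' := monic_gkm ℓ k' m hm
  have d := Polynomial.degree_eq_natDegree h.ne_zero
  have d' := Polynomial.degree_eq_natDegree h'.ne_zero
  rw [natDegree_gkm hm hk hkℓ] at d
  rw [natDegree_gkm hm hk' hkℓ'] at d'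
  exact (Polynomial.degree_sub_lt_left (d.trans d'.symm) h.ne_zero
    (h.leadingCoeff.trans h'.leadingCoeff.symm)).trans_le d.le

lemma gkm_eval_eq (ℓ k m : ℕ) (hm : 1 ≤ m) (s : S ℓ) : (gkm ℓ k m).eval s =
    (∏ i ∈ Finset.range (m - 1), ∏ p : Fin ℓ, (s - (MvPolynomial.X p + MvPolynomial.C (i : ℂ)))) *
    (∏ i ∈ Finset.univ.filter (fun i : Fin ℓ => (i : ℕ) + 1 < k),
      (s - (MvPolynomial.X i + MvPolynomial.C (-1)))) *
    (∏ i ∈ Finset.univ.filter (fun i : Fin ℓ => k < (i : ℕ) + 1),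
      (s - (MvPolynomial.X i + MvPolynomial.C ((m - 1 : ℕ) : ℂ)))) := by
  rw [gkm_eq ℓ k m hm]
  simp only [Polynomial.eval_mul, Polynomial.eval_prod, Polynomial.eval_sub, Polynomial.eval_X,
    Polynomial.eval_C]

lemma gkm_eval_X_add_eq_zero {ℓ k m : ℕ} (hm : 1 ≤ m) (q : Fin ℓ) {s : ℕ} (hs : s < m - 1) :
    (gkm ℓ k m).eval (MvPolynomial.X q + (s : S ℓ)) = 0 := by
  rw [gkm_eval_eq ℓ k m hm, Finset.prod_eq_zero (Finset.mem_range.2 hs), zero_mul, zero_mul]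
  exact Finset.prod_eq_zero (Finset.mem_univ q) (by simp)

lemma gkm_eval_X_add_sub_one_dvd {ℓ k m : ℕ} (hm : 1 ≤ m) {i j : Fin ℓ} (hij : i < j) :
    (MvPolynomial.X i - MvPolynomial.X j - (m : S ℓ)) ∣
      (gkm ℓ k m).eval (MvPolynomial.X j + ((m - 1 : ℕ) : S ℓ)) := by
  have hij' : (i : ℕ) < j := hij
  rw [gkm_eval_eq ℓ k m hm]
  by_cases h : k < (j : ℕ) + 1
  · refine dvd_mul_of_dvd_right ?_ _
    rw [Finset.prod_eq_zero (i := j) (by simpa using h) (by simp)]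
    exact dvd_zero _
  · refine dvd_mul_of_dvd_left (dvd_mul_of_dvd_right ?_ _) _
    have hi : i ∈ Finset.univ.filter (fun i : Fin ℓ => (i : ℕ) + 1 < k) := by
      simp only [Finset.mem_filter, Finset.mem_univ, true_and]; omega
    refine dvd_trans ⟨-1, ?_⟩ (Finset.dvd_prod_of_mem _ hi)
    rw [Nat.cast_sub hm, map_neg, map_one]
    push_cast
    ring

lemma eval_add_natCast_sub_eval_s16 {A : Type*} [CommRing A] {f g : Polynomial A}
    (hfg : f.comp (Polynomial.X + 1) - f = g) (a : A) (n : ℕ) :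
    f.eval (a + n) - f.eval a = ∑ s ∈ Finset.range n, g.eval (a + s) := by
  have h : ∀ b, g.eval b = f.eval (b + 1) - f.eval b := fun b => by
    rw [← hfg]; simp
  have := Finset.sum_range_sub (fun s : ℕ => f.eval (a + s)) n
  simp only [Nat.cast_zero, add_zero] at this
  rw [← this]
  refine Finset.sum_congr rfl fun s _ => ?_
  rw [h]; push_cast; rw [add_assoc]

lemma dvd_eval_sub_eval {A : Type*} [CommRing A] {f g : Polynomial A}
    (hfg : f.comp (Polynomial.X + 1) - f = g) (a b : A) (n : ℕ)
    (h : ∀ s < n, (a - b - n) ∣ g.eval (b + s)) : (a - b - n) ∣ f.eval a - f.eval b := by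
  have h₁ := Polynomial.sub_dvd_eval_sub a (b + n) f
  rw [← sub_sub] at h₁
  have h₂ : (a - b - n) ∣ f.eval (b + n) - f.eval b := by
    rw [eval_add_natCast_sub_eval_s16 hfg]
    exact Finset.dvd_sum fun s hs => h s (Finset.mem_range.1 hs)
  simpa using h₁.add h₂

/-- The derivation `τ_k^m` is logarithmic along the affine `m`-Shi arrangement. -/
lemma dvd_tauVF_sub_tauVF {ℓ k m : ℕ} (hm : 1 ≤ m) {f : Polynomial (S ℓ)}
    (hf : f.comp (Polynomial.X + 1) - f = gkm ℓ k m) {i j : Fin ℓ} (hij : i < j) (p : ℤ)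
    (hp : 1 - (m : ℤ) ≤ p) (hp' : p ≤ m) :
    (MvPolynomial.X i - MvPolynomial.X j - (p : S ℓ)) ∣ tauVF ℓ f i - tauVF ℓ f j := by
  have h : tauVF ℓ f i - tauVF ℓ f j =
      -(ℓ : S ℓ) * (f.eval (MvPolynomial.X i) - f.eval (MvPolynomial.X j)) := by
    simp [tauVF]; ring
  rw [h]
  refine dvd_mul_of_dvd_right ?_ _
  rcases le_total 0 p with h0 | h0
  · lift p to ℕ using h0
    rw [Int.cast_natCast]
    refine dvd_eval_sub_eval hf _ _ _ fun s hs => ?_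
    rcases Nat.lt_or_ge s (m - 1) with hlt | hge
    · rw [gkm_eval_X_add_eq_zero hm j hlt]; exact dvd_zero _
    · obtain rfl : s = m - 1 := by omega
      obtain rfl : p = m := by omega
      exact gkm_eval_X_add_sub_one_dvd hm hij
  · obtain ⟨n, rfl⟩ : ∃ n : ℕ, p = -n := ⟨p.natAbs, by omega⟩
    have := dvd_eval_sub_eval hf (MvPolynomial.X j) (MvPolynomial.X i) n fun s hs => by
      rw [gkm_eval_X_add_eq_zero hm i (by omega)]; exact dvd_zero _
    rw [← neg_dvd, ← dvd_neg]
    convert this using 1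
    · push_cast; ring
    · ring

lemma totalDegree_tauVF_le {ℓ k m : ℕ} (hm : 1 ≤ m) (hk : 1 ≤ k) (hkℓ : k ≤ ℓ)
    {f : Polynomial (S ℓ)} (hf : f.comp (Polynomial.X + 1) - f = gkm ℓ k m) (i : Fin ℓ) :
    (tauVF ℓ f i).totalDegree ≤ ℓ * m := by
  have hpos : 1 ≤ ℓ * m := Nat.mul_pos (by omega) hm
  refine MvPolynomial.totalDegree_finsetSum_le fun j _ =>
    totalDegree_eval_sub_eval_le f (fun n hn e he => ?_) i j
  have := degree_add_le_of_antidifference hf (jointDegreeLE_gkm hm hk hkℓ) n hn e he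
  omega

lemma homog_eq_sum {ℓ : ℕ} (d : ℕ) {f : S ℓ} {T : Finset (Fin ℓ →₀ ℕ)} (hT : f.support ⊆ T) :
    homog ℓ d f = ∑ e ∈ T, MvPolynomial.monomial (Finsupp.mapDomain Fin.castSucc e +
      Finsupp.single (Fin.last ℓ) (d - e.sum fun _ n => n)) (MvPolynomial.coeff e f) :=
  Finset.sum_subset hT fun e _ he => by
    rw [MvPolynomial.notMem_support_iff.1 he, MvPolynomial.monomial_zero]

/-- Homogenization as an additive map. -/
def homogHom (ℓ d : ℕ) : S ℓ →+ R ℓ where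
  toFun := homog ℓ d
  map_zero' := by simp [homog]
  map_add' f g := by
    classical
    rw [homog_eq_sum d (MvPolynomial.support_add (p := f) (q := g)),
      homog_eq_sum d (Finset.subset_union_left (s₁ := f.support) (s₂ := g.support)),
      homog_eq_sum d (Finset.subset_union_right (s₁ := f.support) (s₂ := g.support)),
      ← Finset.sum_add_distrib]
    simp only [MvPolynomial.coeff_add, map_add]

lemma homogHom_apply (ℓ d : ℕ) (f : S ℓ) : homogHom ℓ d f = homog ℓ d f := rfl

lemma homog_monomial (ℓ d : ℕ) (e : Fin ℓ →₀ ℕ) (c : ℂ) :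
    homog ℓ d (MvPolynomial.monomial e c) =
      MvPolynomial.monomial (Finsupp.mapDomain Fin.castSucc e +
        Finsupp.single (Fin.last ℓ) (d - e.sum fun _ n => n)) c := by
  rw [homog_eq_sum d MvPolynomial.support_monomial_subset, Finset.sum_singleton,
    MvPolynomial.coeff_monomial, if_pos rfl]

lemma homog_mul {ℓ a b : ℕ} {f g : S ℓ} (hf : f.totalDegree ≤ a) (hg : g.totalDegree ≤ b) :
    homog ℓ (a + b) (f * g) = homog ℓ a f * homog ℓ b g := by
  conv_lhs => rw [f.as_sum, g.as_sum, Finset.sum_mul_sum, ← homogHom_apply]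
  rw [homog, homog, Finset.sum_mul_sum]
  simp only [map_sum]
  refine Finset.sum_congr rfl fun e he => Finset.sum_congr rfl fun e' he' => ?_
  have h := (MvPolynomial.le_totalDegree he).trans hf
  have h' := (MvPolynomial.le_totalDegree he').trans hg
  rw [MvPolynomial.monomial_mul, MvPolynomial.monomial_mul, homogHom_apply, homog_monomial,
    Finsupp.mapDomain_add, Finsupp.sum_add_index' (fun _ => rfl) (fun _ _ _ => rfl),
    add_add_add_comm, ← Finsupp.single_add]
  congr 4
  omega

lemma homog_linear_form {ℓ : ℕ} (i j : Fin ℓ) (p : ℤ) :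
    homog ℓ 1 (MvPolynomial.X i - MvPolynomial.X j - (p : S ℓ)) =
      MvPolynomial.X i.castSucc - MvPolynomial.X j.castSucc -
        (p : R ℓ) * MvPolynomial.X (Fin.last ℓ) := by
  have hX : ∀ i : Fin ℓ, homogHom ℓ 1 (MvPolynomial.X i) = MvPolynomial.X i.castSucc := fun i => by
    rw [homogHom_apply, MvPolynomial.X, homog_monomial]
    simp [MvPolynomial.X]
  have hC : homogHom ℓ 1 (p : S ℓ) = (p : R ℓ) * MvPolynomial.X (Fin.last ℓ) := by
    rw [← map_intCast (MvPolynomial.C (σ := Fin ℓ) (R := ℂ)), homogHom_apply,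
      MvPolynomial.C_apply, homog_monomial, ← map_intCast (MvPolynomial.C (R := ℂ)),
      MvPolynomial.X, MvPolynomial.C_mul_monomial]
    simp
  rw [← homogHom_apply, map_sub, map_sub, hX, hX, hC]

lemma totalDegree_homog_le {ℓ d : ℕ} {f : S ℓ} (hf : f.totalDegree ≤ d) :
    (homog ℓ d f).totalDegree ≤ d := by
  refine MvPolynomial.totalDegree_finsetSum_le fun e he => ?_
  refine (MvPolynomial.totalDegree_monomial_le _ _).trans ?_
  have h := (MvPolynomial.le_totalDegree he).trans hf
  rw [Finsupp.sum_add_index' (fun _ => rfl) (fun _ _ _ => rfl),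
    Finsupp.sum_mapDomain_index (fun _ => rfl) (fun _ _ _ => rfl),
    Finsupp.sum_single_index rfl]
  change (e.sum fun _ n => n) + (d - e.sum fun _ n => n) ≤ d
  omega

/-- Setting `z = 1` undoes homogenization. -/
lemma eval_snoc_one_homog {ℓ : ℕ} (d : ℕ) (f : S ℓ) (x : Fin ℓ → ℂ) :
    MvPolynomial.eval (Fin.snoc x 1 : Fin (ℓ + 1) → ℂ) (homog ℓ d f) = MvPolynomial.eval x f := by
  rw [homog, map_sum, MvPolynomial.eval_eq']
  refine Finset.sum_congr rfl fun e _ => ?_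
  rw [MvPolynomial.eval_monomial, Finsupp.prod_add_index' (by simp) (fun _ _ _ => pow_add _ _ _),
    Finsupp.prod_mapDomain_index (by simp) (fun _ _ _ => pow_add _ _ _),
    Finsupp.prod_single_index (by simp), Finsupp.prod_fintype _ _ (by simp)]
  simp

lemma totalDegree_linear_form {ℓ : ℕ} {i j : Fin ℓ} (hij : i ≠ j) (c : ℂ) :
    (MvPolynomial.X i - MvPolynomial.X j - MvPolynomial.C c : S ℓ).totalDegree = 1 := by
  refine le_antisymm ?_ ?_
  · refine (MvPolynomial.totalDegree_sub _ _).trans (max_le ?_ (by simp))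
    refine (MvPolynomial.totalDegree_sub _ _).trans (max_le ?_ ?_) <;> simp
  · have := MvPolynomial.le_totalDegree (p := (MvPolynomial.X i - MvPolynomial.X j -
      MvPolynomial.C c : S ℓ)) (s := Finsupp.single i 1) (by
        classical
        rw [MvPolynomial.mem_support_iff]
        have h : Finsupp.single j 1 ≠ Finsupp.single i 1 := fun h =>
          hij (Finsupp.single_left_injective one_ne_zero h).symm
        have h' : (0 : Fin ℓ →₀ ℕ) ≠ Finsupp.single i 1 := fun h' => by
          have := DFunLike.congr_fun h' i
          simp at this
        simp [MvPolynomial.coeff_X, MvPolynomial.coeff_C, h, h'])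
    simpa using this

lemma homog_linear_form_dvd {ℓ d : ℕ} {i j : Fin ℓ} (hij : i ≠ j) (p : ℤ) {f : S ℓ}
    (hf : f.totalDegree ≤ d) (h : (MvPolynomial.X i - MvPolynomial.X j - (p : S ℓ)) ∣ f) :
    (MvPolynomial.X i.castSucc - MvPolynomial.X j.castSucc -
      (p : R ℓ) * MvPolynomial.X (Fin.last ℓ)) ∣ homog ℓ d f := by
  have hdeg : (MvPolynomial.X i - MvPolynomial.X j - (p : S ℓ)).totalDegree = 1 := by
    rw [← map_intCast (MvPolynomial.C (σ := Fin ℓ) (R := ℂ))]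
    exact totalDegree_linear_form hij _
  obtain ⟨u, rfl⟩ := h
  rcases eq_or_ne u 0 with rfl | hu
  · rw [mul_zero, ← homogHom_apply, map_zero]; exact dvd_zero _
  · rw [MvPolynomial.totalDegree_mul_of_isDomain (by rintro h; simp [h] at hdeg) hu, hdeg] at hf
    obtain ⟨b, rfl⟩ : ∃ b, d = 1 + b := ⟨d - 1, by omega⟩
    rw [homog_mul hdeg.le (by omega), homog_linear_form]
    exact dvd_mul_right _ _

lemma vfHomog_castSucc {ℓ : ℕ} (δ : Fin ℓ → S ℓ) (i : Fin ℓ) : vfHomog ℓ δ i.castSucc =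
    homog ℓ (Finset.univ.sup fun a => (δ a).totalDegree) (δ i) := by
  simp [vfHomog]

lemma vfHomog_last {ℓ : ℕ} (δ : Fin ℓ → S ℓ) : vfHomog ℓ δ (Fin.last ℓ) = 0 := by
  simp [vfHomog]

lemma vfHomog_mem_DcShi {ℓ m : ℕ} {δ : Fin ℓ → S ℓ}
    (h : ∀ i j : Fin ℓ, i < j → ∀ p : ℤ, 1 - (m : ℤ) ≤ p → p ≤ m →
      (MvPolynomial.X i - MvPolynomial.X j - (p : S ℓ)) ∣ δ i - δ j) :
    vfHomog ℓ δ ∈ DcShi ℓ m := by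
  refine ⟨by rw [vfHomog_last]; exact dvd_zero _, fun i j hij p hp hp' => ?_⟩
  rw [vfHomog_last, mul_zero, sub_zero, vfHomog_castSucc, vfHomog_castSucc, ← homogHom_apply,
    ← homogHom_apply, ← map_sub]
  refine homog_linear_form_dvd hij.ne p ?_ (h i j hij p hp hp')
  exact (MvPolynomial.totalDegree_sub _ _).trans (max_le
    (Finset.le_sup (f := fun a => (δ a).totalDegree) (Finset.mem_univ i))
    (Finset.le_sup (f := fun a => (δ a).totalDegree) (Finset.mem_univ j)))

lemma totalDegree_vfHomog_le {ℓ d : ℕ} {δ : Fin ℓ → S ℓ} (h : ∀ i, (δ i).totalDegree ≤ d)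
    (i : Fin (ℓ + 1)) : (vfHomog ℓ δ i).totalDegree ≤ d := by
  refine Fin.lastCases ?_ (fun i => ?_) i
  · simp [vfHomog_last]
  · rw [vfHomog_castSucc]
    exact (totalDegree_homog_le (Finset.le_sup (f := fun a => (δ a).totalDegree)
      (Finset.mem_univ i))).trans (Finset.sup_le fun a _ => h a)

lemma theta0c_mem_DcShi (ℓ m : ℕ) : theta0c ℓ ∈ DcShi ℓ m :=
  ⟨by simp [theta0c], fun i j _ p _ _ => by simp [theta0c]⟩

lemma thetaE_mem_DcShi (ℓ m : ℕ) : thetaE ℓ ∈ DcShi ℓ m :=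
  ⟨dvd_rfl, fun _ _ _ _ _ _ => dvd_rfl⟩

lemma shiBasis_mem_DcShi {ℓ m : ℕ} (hm : 1 ≤ m) {F : ℕ → Polynomial (S ℓ)}
    (hF : ∀ k : ℕ, 1 ≤ k → k ≤ ℓ → (F k).comp (Polynomial.X + 1) - F k = gkm ℓ k m)
    (a : Fin (ℓ + 1)) : shiBasis ℓ F a ∈ DcShi ℓ m := by
  have h : ∀ k, 1 ≤ k → k ≤ ℓ → vfHomog ℓ (tauVF ℓ (F k)) ∈ DcShi ℓ m := fun k hk hkℓ =>
    vfHomog_mem_DcShi fun i j hij p hp hp' => dvd_tauVF_sub_tauVF hm (hF k hk hkℓ) hij p hp hp'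
  unfold shiBasis
  split_ifs with h₁ h₂
  · exact sub_mem (h _ (by omega) (by omega)) (h _ (by omega) (by omega))
  · exact theta0c_mem_DcShi ℓ m
  · exact thetaE_mem_DcShi ℓ m

lemma natDegree_le_of_degree_comp_sub_lt {f : Polynomial ℂ} {N : ℕ}
    (h : (f.comp (Polynomial.X + 1) - f).degree < (N : WithBot ℕ)) : f.natDegree ≤ N := by
  by_contra! hN
  obtain ⟨M, hM⟩ : ∃ M, f.natDegree = M + 1 := ⟨f.natDegree - 1, by omega⟩
  have key := map_coeff_comp_X_add_one_sub (AddMonoidHom.id ℂ) f M fun j hj =>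
    Polynomial.coeff_eq_zero_of_natDegree_lt (hM ▸ hj)
  have h0 : (f.comp (Polynomial.X + 1) - f).coeff M = 0 :=
    Polynomial.coeff_eq_zero_of_degree_lt (h.trans_le (by exact_mod_cast (by omega : N ≤ M)))
  rw [AddMonoidHom.id_apply, AddMonoidHom.id_apply, h0, ← hM] at key
  refine smul_ne_zero (by omega) ?_ key.symm
  rw [Polynomial.coeff_natDegree, Ne, Polynomial.leadingCoeff_eq_zero]
  rintro rfl
  simp at hM

lemma gkm_eval_X_sub_one_eq_zero {ℓ k m : ℕ} (hm : 1 ≤ m) {q : Fin ℓ} (hq : (q : ℕ) + 1 < k) :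
    (gkm ℓ k m).eval (MvPolynomial.X q - 1) = 0 := by
  rw [gkm_eval_eq ℓ k m hm, Finset.prod_eq_zero (i := q) (s := Finset.univ.filter _)
    (by simpa using hq) (by rw [map_neg, map_one]; ring), mul_zero, zero_mul]

lemma eval_gkm_eval_X_sub_one_ne_zero {ℓ m : ℕ} (hm : 1 ≤ m) {x : Fin ℓ → ℂ}
    (hx : ∀ i j (r : ℝ), x i - x j = r → i = j) (q : Fin ℓ) :
    MvPolynomial.eval x ((gkm ℓ (q + 1) m).eval (MvPolynomial.X q - 1)) ≠ 0 := by
  rw [gkm_eval_eq ℓ _ m hm]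
  simp only [map_mul, map_prod, map_sub, map_add, MvPolynomial.eval_X, MvPolynomial.eval_C, map_one]
  have h : ∀ (p : Fin ℓ) (r : ℝ), p ≠ q → x q - 1 - (x p + r) ≠ 0 := fun p r hp h0 =>
    hp (hx q p (r + 1) (by push_cast; linear_combination h0)).symm
  refine mul_ne_zero (mul_ne_zero ?_ ?_) ?_
  · refine Finset.prod_ne_zero_iff.2 fun i _ => Finset.prod_ne_zero_iff.2 fun p _ => ?_
    by_cases hp : p = q
    · subst hp
      intro h0
      have : ((i + 1 : ℕ) : ℂ) = 0 := by push_cast; linear_combination -h0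
      exact absurd (Nat.cast_eq_zero.1 this) i.succ_ne_zero
    · exact_mod_cast h p i hp
  · refine Finset.prod_ne_zero_iff.2 fun p hp => ?_
    have hp' : p ≠ q := by rintro rfl; simp at hp
    exact_mod_cast h p (-1) hp'
  · refine Finset.prod_ne_zero_iff.2 fun p hp => ?_
    have hp' : p ≠ q := by rintro rfl; simp at hp
    exact_mod_cast h p ((m - 1 : ℕ) : ℝ) hp'

/-- A combination of the consecutive differences `g_k - g_{k+1}` whose antidifference is constant
on the points `x_i` is trivial. -/
lemma eq_zero_of_antidifference_eval_eq {n m : ℕ} (hm : 1 ≤ m) {x : Fin (n + 1) → ℂ}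
    (hx : ∀ i j (r : ℝ), x i - x j = r → i = j) (c : Fin n → ℂ) (H : Polynomial ℂ) (κ : ℂ)
    (hH : H.comp (Polynomial.X + 1) - H = ∑ a : Fin n, Polynomial.C (c a) *
      (gkm (n + 1) (a + 1) m - gkm (n + 1) (a + 2) m).map (MvPolynomial.eval x))
    (hκ : ∀ i, H.eval (x i) = κ) : c = 0 := by
  set D := ∑ a : Fin n, Polynomial.C (c a) *
    (gkm (n + 1) (a + 1) m - gkm (n + 1) (a + 2) m).map (MvPolynomial.eval x) with hD
  have evalD : ∀ s : S (n + 1), D.eval (MvPolynomial.eval x s) = ∑ a : Fin n, c a *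
      (MvPolynomial.eval x ((gkm (n + 1) (a + 1) m).eval s) -
        MvPolynomial.eval x ((gkm (n + 1) (a + 2) m).eval s)) := fun s => by
    simp [hD, Polynomial.eval_finsetSum, Polynomial.eval_map_apply, Polynomial.map_sub]
  set G := H - Polynomial.C κ with hGdef
  have hG : G.comp (Polynomial.X + 1) - G = D := by rw [← hH, hGdef]; simp
  have hdeg : G.natDegree ≤ (n + 1) * m - 1 := by
    refine natDegree_le_of_degree_comp_sub_lt ?_
    rw [hG]
    refine (Polynomial.degree_sum_le _ _).trans_lt ?_
    rw [Finset.sup_lt_iff (WithBot.bot_lt_coe _)]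
    intro a _
    refine lt_of_le_of_lt ?_ (degree_gkm_sub_gkm_lt (ℓ := n + 1) (k := a + 1) (k' := a + 2) hm
      (by omega) (by omega) (by omega) (by omega))
    rw [← Polynomial.smul_eq_C_mul]
    exact (Polynomial.degree_smul_le _ _).trans Polynomial.degree_map_le
  have hroot : ∀ p : Fin (n + 1) × Fin m, G.eval (x p.1 + ((p.2 : ℕ) : ℂ)) = 0 := by
    rintro ⟨i, s⟩
    have h := eval_add_natCast_sub_eval_s16 hG (x i) s
    have h0 : G.eval (x i) = 0 := by simp [hGdef, hκ]
    rw [h0, sub_zero] at h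
    rw [h]
    refine Finset.sum_eq_zero fun r hr => ?_
    have hr' : r < m - 1 := by have := Finset.mem_range.1 hr; omega
    have := evalD (MvPolynomial.X i + (r : S (n + 1)))
    simpa [gkm_eval_X_add_eq_zero hm i hr'] using this
  have hG0 : G = 0 := by
    refine Polynomial.eq_zero_of_natDegree_lt_card_of_eval_eq_zero G ?_ hroot ?_
    · rintro ⟨i, s⟩ ⟨j, r⟩ h
      dsimp only at h
      obtain rfl : i = j := hx i j ((r : ℕ) - (s : ℕ) : ℝ) (by push_cast; linear_combination h)
      simpa [Fin.ext_iff] using h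
    · have : 1 ≤ (n + 1) * m := Nat.mul_pos n.succ_pos hm
      simp only [Fintype.card_prod, Fintype.card_fin]
      omega
  have hD0 : D = 0 := by rw [← hG, hG0]; simp
  have key : ∀ N, ∀ a : Fin n, (a : ℕ) < N → c a = 0 := by
    intro N
    induction N with
    | zero => intro a ha; omega
    | succ N ih =>
      intro a ha
      have h := evalD (MvPolynomial.X a.castSucc - 1)
      rw [hD0, Polynomial.eval_zero, Finset.sum_eq_single a] at h
      · rw [gkm_eval_X_sub_one_eq_zero (k := a + 2) hm (by simp), map_zero, sub_zero] at h
        exact (mul_eq_zero.1 h.symm).resolve_right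
          (eval_gkm_eval_X_sub_one_ne_zero hm hx a.castSucc)
      · intro b _ hb
        rcases lt_or_gt_of_ne hb with hlt | hgt
        · rw [ih b (by have : (b : ℕ) < a := hlt; omega), zero_mul]
        · have : (a : ℕ) < b := hgt
          rw [gkm_eval_X_sub_one_eq_zero hm (by simpa using this),
            gkm_eval_X_sub_one_eq_zero hm (by simp; omega)]
          simp
      · simp
  funext a
  exact key _ a (Nat.lt_succ_self _)

lemma shiBasis_castSucc_castSucc {n : ℕ} (F : ℕ → Polynomial (S (n + 1))) (a : Fin n) :
    shiBasis (n + 1) F a.castSucc.castSucc = vfHomog (n + 1) (tauVF (n + 1) (F (a + 1))) -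
      vfHomog (n + 1) (tauVF (n + 1) (F (a + 2))) := by
  simp [shiBasis]

lemma shiBasis_castSucc_last {n : ℕ} (F : ℕ → Polynomial (S (n + 1))) :
    shiBasis (n + 1) F (Fin.last n).castSucc = theta0c (n + 1) := by
  simp [shiBasis]

lemma shiBasis_last {n : ℕ} (F : ℕ → Polynomial (S (n + 1))) :
    shiBasis (n + 1) F (Fin.last (n + 1)) = thetaE (n + 1) := by
  simp [shiBasis]

lemma eval_tauVF {ℓ : ℕ} (f : Polynomial (S ℓ)) (x : Fin ℓ → ℂ) (i : Fin ℓ) :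
    MvPolynomial.eval x (tauVF ℓ f i) =
      ∑ j, (f.map (MvPolynomial.eval x)).eval (x j) -
        ℓ * (f.map (MvPolynomial.eval x)).eval (x i) := by
  have h : ∀ j, (f.map (MvPolynomial.eval x)).eval (x j) =
      MvPolynomial.eval x (f.eval (MvPolynomial.X j)) := fun j => by
    rw [← Polynomial.eval_map_apply, MvPolynomial.eval_X]
  simp [tauVF, h]

lemma det_shiBasis_ne_zero {ℓ m : ℕ} (hℓ : 2 ≤ ℓ) (hm : 1 ≤ m) {F : ℕ → Polynomial (S ℓ)}
    (hF : ∀ k : ℕ, 1 ≤ k → k ≤ ℓ → (F k).comp (Polynomial.X + 1) - F k = gkm ℓ k m) :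
    (Matrix.of (shiBasis ℓ F)).det ≠ 0 := by
  obtain ⟨n, rfl⟩ : ∃ n, ℓ = n + 1 := ⟨ℓ - 1, by omega⟩
  let x : Fin (n + 1) → ℂ := fun i => (i : ℕ) * Complex.I
  have hx : ∀ i j (r : ℝ), x i - x j = r → i = j := fun i j r h => by
    have := congrArg Complex.im h
    simp only [x, Complex.sub_im, Complex.mul_im, Complex.natCast_re, Complex.natCast_im,
      Complex.I_im, Complex.I_re, Complex.ofReal_im] at this
    have h' : ((i : ℕ) : ℝ) = (j : ℕ) := by linarith
    exact Fin.ext (by exact_mod_cast h')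
  set φ := MvPolynomial.eval (Fin.snoc x 1 : Fin (n + 2) → ℂ) with hφ
  intro hdet
  have hdet' : (φ.mapMatrix (Matrix.of (shiBasis (n + 1) F))).det = 0 := by
    rw [← RingHom.map_det, hdet, map_zero]
  obtain ⟨c, hc, hc0⟩ := Matrix.exists_vecMul_eq_zero_iff.2 hdet'
  have hcol : ∀ i, ∑ a, c a * φ (shiBasis (n + 1) F a i) = 0 := fun i => by
    simpa [Matrix.vecMul, dotProduct] using congrFun hc0 i
  have hE : c (Fin.last (n + 1)) = 0 := by
    have h := hcol (Fin.last (n + 1))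
    rw [Fin.sum_univ_castSucc, Fin.sum_univ_castSucc] at h
    simpa [shiBasis_castSucc_castSucc, shiBasis_castSucc_last, shiBasis_last, vfHomog_last,
      theta0c, thetaE, hφ] using h
  set H : Polynomial ℂ := ∑ a : Fin n, Polynomial.C (c a.castSucc.castSucc) *
    (F (a + 1) - F (a + 2)).map (MvPolynomial.eval x) with hH
  have hrow : ∀ i : Fin (n + 1), ∑ j, H.eval (x j) - ((n + 1 : ℕ) : ℂ) * H.eval (x i) +
      c (Fin.last n).castSucc = 0 := fun i => by
    have h := hcol i.castSucc
    rw [Fin.sum_univ_castSucc, Fin.sum_univ_castSucc, hE, zero_mul, add_zero,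
      shiBasis_castSucc_last] at h
    rw [← h]
    congr 1
    · simp only [hH, Polynomial.eval_finsetSum, Polynomial.eval_mul, Polynomial.eval_C,
        Polynomial.map_sub, Polynomial.eval_sub, shiBasis_castSucc_castSucc, Pi.sub_apply, map_sub,
        vfHomog_castSucc, hφ, eval_snoc_one_homog, eval_tauVF]
      rw [Finset.sum_comm, Finset.mul_sum, ← Finset.sum_sub_distrib]
      refine Finset.sum_congr rfl fun a _ => ?_
      rw [← Finset.mul_sum, Finset.sum_sub_distrib]
      ring
    · rw [theta0c, if_pos (show (i.castSucc : ℕ) < n + 1 from i.isLt), map_one, mul_one]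
  have hne : ((n + 1 : ℕ) : ℂ) ≠ 0 := Nat.cast_ne_zero.2 n.succ_ne_zero
  have h0 : c (Fin.last n).castSucc = 0 := by
    have h := Finset.sum_eq_zero fun i (_ : i ∈ Finset.univ) => hrow i
    rw [Finset.sum_add_distrib, Finset.sum_sub_distrib, ← Finset.mul_sum] at h
    simp only [Finset.sum_const, Finset.card_univ, Fintype.card_fin, nsmul_eq_mul, sub_self,
      zero_add] at h
    exact (mul_eq_zero.1 h).resolve_left hne
  have hc' := eq_zero_of_antidifference_eval_eq hm hx (fun a => c a.castSucc.castSucc) H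
    ((∑ j, H.eval (x j)) / ((n + 1 : ℕ) : ℂ)) (by
      rw [hH, Polynomial.sum_comp, ← Finset.sum_sub_distrib]
      refine Finset.sum_congr rfl fun a _ => ?_
      rw [← hF (a + 1) (by omega) (by omega), ← hF (a + 2) (by omega) (by omega)]
      simp only [Polynomial.mul_comp, Polynomial.C_comp, Polynomial.map_sub, Polynomial.map_comp,
        Polynomial.sub_comp, Polynomial.map_add, Polynomial.map_X, Polynomial.map_one]
      ring)
    (fun i => by
      rw [eq_div_iff hne]
      have := hrow i
      rw [h0] at this
      linear_combination -this)
  refine hc (funext fun a => ?_)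
  refine Fin.lastCases hE (fun a => ?_) a
  exact Fin.lastCases h0 (fun a => congrFun hc' a) a

/-- The linear form `x_i - x_j - p z`. -/
def shiForm {ℓ : ℕ} (t : Fin ℓ × Fin ℓ × ℤ) : R ℓ :=
  MvPolynomial.X t.1.castSucc - MvPolynomial.X t.2.1.castSucc -
    (t.2.2 : R ℓ) * MvPolynomial.X (Fin.last ℓ)

/-- The triples `(i, j, p)` with `i < j` and `1 - m ≤ p ≤ m`. -/
def shiIndex (ℓ m : ℕ) : Finset (Fin ℓ × Fin ℓ × ℤ) :=
  Finset.univ.sigma (fun i : Fin ℓ => Finset.Ioi i ×ˢ Finset.Icc (1 - (m : ℤ)) m)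
    |>.map (Equiv.sigmaEquivProd _ _).toEmbedding

lemma mem_shiIndex {ℓ m : ℕ} {t : Fin ℓ × Fin ℓ × ℤ} :
    t ∈ shiIndex ℓ m ↔ t.1 < t.2.1 ∧ 1 - (m : ℤ) ≤ t.2.2 ∧ t.2.2 ≤ m := by
  rw [shiIndex, Finset.mem_map_equiv]
  simp

lemma card_shiIndex (ℓ m : ℕ) : (shiIndex ℓ m).card = (ℓ - 1) * (ℓ * m) := by
  rw [shiIndex, Finset.card_map, Finset.card_sigma]
  simp only [Finset.card_product, Fin.card_Ioi, Int.card_Icc]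
  have h : ((m : ℤ) + 1 - (1 - (m : ℤ))).toNat = 2 * m := by omega
  rw [← Finset.sum_mul, h, Fin.sum_univ_eq_sum_range (fun i => ℓ - 1 - i),
    Finset.sum_range_reflect (fun i => i), ← mul_assoc, Finset.sum_range_id_mul_two]
  ring

/-- The defining polynomial of `cShi_ℓ(m)`. -/
def shiPoly (ℓ m : ℕ) : R ℓ := MvPolynomial.X (Fin.last ℓ) * ∏ t ∈ shiIndex ℓ m, shiForm t

lemma coeff_single_shiForm {ℓ : ℕ} (t : Fin ℓ × Fin ℓ × ℤ) (ht : t.1 ≠ t.2.1) :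
    MvPolynomial.coeff (Finsupp.single t.1.castSucc 1) (shiForm t) = 1 := by
  classical
  have h : ∀ i : Fin (ℓ + 1), t.1.castSucc ≠ i →
      Finsupp.single i 1 ≠ Finsupp.single t.1.castSucc 1 := fun i hi h =>
    hi (Finsupp.single_left_injective one_ne_zero h).symm
  have h₁ := h t.2.1.castSucc (by simpa using ht)
  have h₂ := h (Fin.last ℓ) (Fin.castSucc_ne_last _)
  rw [shiForm, ← map_intCast (MvPolynomial.C (R := ℂ)), MvPolynomial.coeff_sub,
    MvPolynomial.coeff_sub, MvPolynomial.coeff_C_mul]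
  simp [MvPolynomial.coeff_X, h₁, h₂]

lemma totalDegree_shiForm {ℓ : ℕ} (t : Fin ℓ × Fin ℓ × ℤ) (ht : t.1 ≠ t.2.1) :
    (shiForm t).totalDegree = 1 := by
  refine le_antisymm ?_ ?_
  · refine (MvPolynomial.totalDegree_sub _ _).trans (max_le ?_ ?_)
    · refine (MvPolynomial.totalDegree_sub _ _).trans (max_le ?_ ?_) <;> simp
    · rw [← map_intCast (MvPolynomial.C (R := ℂ))]
      refine (MvPolynomial.totalDegree_mul _ _).trans ?_
      rw [MvPolynomial.totalDegree_C, MvPolynomial.totalDegree_X]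
  · have := MvPolynomial.le_totalDegree (p := shiForm t) (s := Finsupp.single t.1.castSucc 1) (by
      rw [MvPolynomial.mem_support_iff, coeff_single_shiForm t ht]; exact one_ne_zero)
    simpa using this

lemma irreducible_shiForm {ℓ : ℕ} (t : Fin ℓ × Fin ℓ × ℤ) (ht : t.1 ≠ t.2.1) :
    Irreducible (shiForm t) :=
  MvPolynomial.irreducible_of_totalDegree_eq_one (totalDegree_shiForm t ht) fun _ hc =>
    isUnit_of_dvd_one (coeff_single_shiForm t ht ▸ hc (Finsupp.single t.1.castSucc 1))

lemma eval_snoc_shiForm {ℓ : ℕ} (t : Fin ℓ × Fin ℓ × ℤ) (x : Fin ℓ → ℂ) (z : ℂ) :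
    MvPolynomial.eval (Fin.snoc x z : Fin (ℓ + 1) → ℂ) (shiForm t) =
      x t.1 - x t.2.1 - t.2.2 * z := by
  simp [shiForm]

lemma not_shiForm_dvd_shiForm {ℓ : ℕ} {t u : Fin ℓ × Fin ℓ × ℤ} (ht : t.1 < t.2.1)
    (hu : u.1 < u.2.1) (htu : t ≠ u) : ¬ shiForm t ∣ shiForm u := by
  intro hdvd
  have key : ∀ (x : Fin ℓ → ℂ) (z : ℂ), x t.1 - x t.2.1 - t.2.2 * z = 0 →
      x u.1 - x u.2.1 - u.2.2 * z = 0 := fun x z h => by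
    have := map_dvd (MvPolynomial.eval (Fin.snoc x z : Fin (ℓ + 1) → ℂ)) hdvd
    rwa [eval_snoc_shiForm, eval_snoc_shiForm, h, zero_dvd_iff] at this
  obtain ⟨i, j, p⟩ := t
  obtain ⟨a, b, q⟩ := u
  dsimp only at ht hu key
  have h₁ := key (fun k => if k = i then ((j : ℕ) : ℂ) else ((k : ℕ) : ℂ)) 0 (by simp [ht.ne'])
  have h₂ : a = i ∧ b = j := by
    rw [mul_zero, sub_zero, sub_eq_zero] at h₁
    split_ifs at h₁ with ha hb hb
    · exact absurd hu (by rw [ha, hb]; exact lt_irrefl _)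
    · exact ⟨ha, Fin.ext (by exact_mod_cast h₁.symm)⟩
    · have h₃ : (a : ℕ) = j := by exact_mod_cast h₁
      subst hb
      exact absurd (hu.trans ht) (by rw [Fin.ext h₃]; exact lt_irrefl _)
    · have h₃ : (a : ℕ) = b := by exact_mod_cast h₁
      exact absurd hu (by rw [Fin.ext h₃]; exact lt_irrefl _)
  obtain ⟨rfl, rfl⟩ := h₂
  have h₃ := key (fun k => if k = a then (p : ℂ) else 0) 1 (by simp [ht.ne'])
  simp only [if_true, hu.ne', if_false, sub_zero, mul_one, sub_eq_zero] at h₃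
  exact htu (by rw [show p = q by exact_mod_cast h₃])

lemma not_shiForm_dvd_X_last {ℓ : ℕ} (t : Fin ℓ × Fin ℓ × ℤ) (ht : t.1 ≠ t.2.1) :
    ¬ shiForm t ∣ (MvPolynomial.X (Fin.last ℓ) : R ℓ) := by
  intro hdvd
  have := map_dvd (MvPolynomial.eval
    (Fin.snoc (fun k => if k = t.1 then (t.2.2 : ℂ) else 0) 1 : Fin (ℓ + 1) → ℂ)) hdvd
  rw [eval_snoc_shiForm] at this
  simp [ht.symm] at this

lemma totalDegree_shiPoly (ℓ m : ℕ) :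
    shiPoly ℓ m ≠ 0 ∧ (shiPoly ℓ m).totalDegree = 1 + (ℓ - 1) * (ℓ * m) := by
  have h : ∀ T : Finset (Fin ℓ × Fin ℓ × ℤ), (∀ t ∈ T, t.1 ≠ t.2.1) →
      ∏ t ∈ T, shiForm t ≠ 0 ∧ (∏ t ∈ T, shiForm t).totalDegree = T.card := by
    classical
    intro T
    induction T using Finset.induction_on with
    | empty => simp
    | insert t T hT ih =>
      intro hmem
      obtain ⟨h₁, h₂⟩ := ih fun u hu => hmem u (by simp [hu])
      have h₃ := (irreducible_shiForm t (hmem t (by simp))).ne_zero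
      rw [Finset.prod_insert hT, Finset.card_insert_of_notMem hT]
      refine ⟨mul_ne_zero h₃ h₁, ?_⟩
      rw [MvPolynomial.totalDegree_mul_of_isDomain h₃ h₁, h₂,
        totalDegree_shiForm t (hmem t (by simp)), add_comm]
  obtain ⟨h₁, h₂⟩ := h (shiIndex ℓ m) fun t ht => (mem_shiIndex.1 ht).1.ne
  have hX := MvPolynomial.X_ne_zero (R := ℂ) (Fin.last ℓ)
  refine ⟨mul_ne_zero hX h₁, ?_⟩
  rw [shiPoly, MvPolynomial.totalDegree_mul_of_isDomain hX h₁, h₂, card_shiIndex,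
    MvPolynomial.totalDegree_X]

lemma dvd_det_of_dvd_mulVec {n A : Type*} [Fintype n] [DecidableEq n] [CommRing A]
    (M : Matrix n n A) (w : n → A) (i : n) (hi : w i = 1) {α : A} (h : ∀ a, α ∣ M.mulVec w a) :
    α ∣ M.det := by
  have h₁ := congrFun (Matrix.mulVec_mulVec w M.adjugate M) i
  rw [Matrix.adjugate_mul, Matrix.smul_mulVec, Matrix.one_mulVec, Pi.smul_apply, hi,
    smul_eq_mul, mul_one] at h₁
  rw [← h₁]
  exact Finset.dvd_sum fun a _ => dvd_mul_of_dvd_right (h a) _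

/-- One half of Saito's criterion. -/
lemma shiPoly_dvd_det {ℓ m : ℕ} (M : Matrix (Fin (ℓ + 1)) (Fin (ℓ + 1)) (R ℓ))
    (hM : ∀ a, M a ∈ DcShi ℓ m) : shiPoly ℓ m ∣ M.det := by
  have hform : ∀ t ∈ shiIndex ℓ m, shiForm t ∣ M.det := fun t ht => by
    obtain ⟨hij, hp, hp'⟩ := mem_shiIndex.1 ht
    refine dvd_det_of_dvd_mulVec M (Pi.single t.1.castSucc 1 - Pi.single t.2.1.castSucc 1 -
      (t.2.2 : R ℓ) • Pi.single (Fin.last ℓ) 1) t.1.castSucc ?_ fun a => ?_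
    · simp [hij.ne, Fin.castSucc_ne_last]
    · rw [Matrix.mulVec_sub, Matrix.mulVec_sub, Matrix.mulVec_smul]
      simpa [shiForm] using (hM a).2 _ _ hij _ hp hp'
  have hX : MvPolynomial.X (Fin.last ℓ) ∣ M.det :=
    dvd_det_of_dvd_mulVec M (Pi.single (Fin.last ℓ) 1) (Fin.last ℓ) (by simp) fun a => by
      simpa using (hM a).1
  refine IsRelPrime.mul_dvd (IsRelPrime.prod_right fun t ht => ?_) hX
    (Finset.prod_dvd_of_isRelPrime (fun t ht u hu htu => ?_) hform)
  · have h := (mem_shiIndex.1 ht).1.ne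
    exact ((irreducible_shiForm t h).isRelPrime_iff_not_dvd.2 (not_shiForm_dvd_X_last t h)).symm
  · have ht' := (mem_shiIndex.1 (Finset.mem_coe.1 ht)).1
    have hu' := (mem_shiIndex.1 (Finset.mem_coe.1 hu)).1
    exact (irreducible_shiForm t ht'.ne).isRelPrime_iff_not_dvd.2
      (not_shiForm_dvd_shiForm ht' hu' htu)

lemma totalDegree_det_le {n σ A : Type*} [Fintype n] [DecidableEq n] [CommRing A]
    (M : Matrix n n (MvPolynomial σ A)) (d : n → ℕ) (h : ∀ i j, (M i j).totalDegree ≤ d i) :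
    M.det.totalDegree ≤ ∑ i, d i := by
  rw [← Matrix.det_transpose, Matrix.det_apply]
  refine MvPolynomial.totalDegree_finsetSum_le fun s _ => ?_
  refine (MvPolynomial.totalDegree_smul_le _ _).trans ?_
  exact (MvPolynomial.totalDegree_finsetProd _ _).trans (Finset.sum_le_sum fun i _ => h _ _)

lemma totalDegree_det_shiBasis_le {ℓ m : ℕ} (hℓ : 2 ≤ ℓ) (hm : 1 ≤ m) {F : ℕ → Polynomial (S ℓ)}
    (hF : ∀ k : ℕ, 1 ≤ k → k ≤ ℓ → (F k).comp (Polynomial.X + 1) - F k = gkm ℓ k m) :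
    (Matrix.of (shiBasis ℓ F)).det.totalDegree ≤ 1 + (ℓ - 1) * (ℓ * m) := by
  obtain ⟨n, rfl⟩ : ∃ n, ℓ = n + 1 := ⟨ℓ - 1, by omega⟩
  refine (totalDegree_det_le _ (fun a : Fin (n + 1 + 1) => if (a : ℕ) < n then (n + 1) * m else
    if (a : ℕ) = n then 0 else 1) fun a i => ?_).trans ?_
  · have h : ∀ k, 1 ≤ k → k ≤ n + 1 →
        (vfHomog (n + 1) (tauVF (n + 1) (F k)) i).totalDegree ≤ (n + 1) * m := fun k hk hk' =>
      totalDegree_vfHomog_le (fun i => totalDegree_tauVF_le hm hk hk' (hF k hk hk') i) i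
    simp only [Matrix.of_apply, shiBasis, Nat.add_sub_cancel]
    split_ifs with h₁ h₂
    · exact (MvPolynomial.totalDegree_sub _ _).trans
        (max_le (h _ (by omega) (by omega)) (h _ (by omega) (by omega)))
    · unfold theta0c
      split_ifs <;> simp
    · simp [thetaE]
  · rw [Fin.sum_univ_castSucc, Fin.sum_univ_castSucc]
    simp [add_comm]

lemma exists_det_shiBasis_eq {ℓ m : ℕ} (hℓ : 2 ≤ ℓ) (hm : 1 ≤ m) {F : ℕ → Polynomial (S ℓ)}
    (hF : ∀ k : ℕ, 1 ≤ k → k ≤ ℓ → (F k).comp (Polynomial.X + 1) - F k = gkm ℓ k m) :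
    ∃ u : (R ℓ)ˣ, (Matrix.of (shiBasis ℓ F)).det = shiPoly ℓ m * u := by
  obtain ⟨h, hh⟩ := shiPoly_dvd_det (Matrix.of (shiBasis ℓ F)) (shiBasis_mem_DcShi hm hF)
  have hne := det_shiBasis_ne_zero hℓ hm hF
  have hle := totalDegree_det_shiBasis_le hℓ hm hF
  obtain ⟨hQ, hdeg⟩ := totalDegree_shiPoly ℓ m
  rw [hh] at hne hle
  have hh0 := right_ne_zero_of_mul hne
  rw [MvPolynomial.totalDegree_mul_of_isDomain hQ hh0, hdeg] at hle
  have hC := MvPolynomial.totalDegree_eq_zero_iff_eq_C.1 (by omega : h.totalDegree = 0)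
  have hu : IsUnit h := by
    rw [hC]
    refine (IsUnit.mk0 _ fun h0 => hh0 ?_).map MvPolynomial.C
    rw [hC, h0, map_zero]
  exact ⟨hu.unit, hh⟩

/-- If `det M` divides every determinant obtained by replacing a row of `M` by `v`, then `v` is a
combination of the rows of `M`. -/
lemma mem_span_rows_of_det_dvd {n A : Type*} [Fintype n] [DecidableEq n] [CommRing A] [IsDomain A]
    (M : Matrix n n A) (hM : M.det ≠ 0) (v : n → A) (h : ∀ a, M.det ∣ (M.updateRow a v).det) :
    v ∈ Submodule.span A (Set.range M) := by
  choose u hu using h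
  have h₁ : M.adjugate.vecMul v = M.det • u := by
    funext a
    rw [Pi.smul_apply, smul_eq_mul, ← hu, ← Matrix.cramer_transpose_apply,
      Matrix.cramer_eq_adjugate_mulVec, ← Matrix.adjugate_transpose, Matrix.mulVec_transpose]
  have h₂ : M.det • v = M.det • M.vecMul u := by
    rw [← Matrix.smul_vecMul, ← h₁, Matrix.vecMul_vecMul, Matrix.adjugate_mul,
      Matrix.vecMul_smul, Matrix.vecMul_one]
  rw [smul_right_injective _ hM h₂, Matrix.vecMul_eq_sum]
  exact Submodule.sum_mem _ fun a _ => Submodule.smul_mem _ _ (Submodule.subset_span ⟨a, rfl⟩)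

theorem stmt16 (ℓ m : ℕ) (hℓ : 2 ≤ ℓ) (hm : 1 ≤ m)
    -- F k is an indefinite summation (antidifference) of g_k^{(m)}(t)
    (F : ℕ → Polynomial (S ℓ))
    (hF : ∀ k : ℕ, 1 ≤ k → k ≤ ℓ →
      (F k).comp (Polynomial.X + 1) - F k = gkm ℓ k m) :
    (∀ a : Fin (ℓ + 1), shiBasis ℓ F a ∈ DcShi ℓ m) ∧
    LinearIndependent (R ℓ) (shiBasis ℓ F) ∧
    (∀ v ∈ DcShi ℓ m,
      v ∈ Submodule.span (R ℓ) (Set.range (shiBasis ℓ F))) := by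
  have hmem := shiBasis_mem_DcShi hm hF
  have hne := det_shiBasis_ne_zero hℓ hm hF
  refine ⟨hmem, Matrix.linearIndependent_rows_of_det_ne_zero hne, fun v hv => ?_⟩
  refine mem_span_rows_of_det_dvd (Matrix.of (shiBasis ℓ F)) hne v fun a => ?_
  obtain ⟨u, hu⟩ := exists_det_shiBasis_eq hℓ hm hF
  rw [hu, Units.mul_right_dvd]
  refine shiPoly_dvd_det _ fun b => ?_
  rcases eq_or_ne b a with rfl | hba
  · rwa [Matrix.updateRow_self]
  · rw [Matrix.updateRow_ne hba]
    exact hmem b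

end
end
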